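/- arXiv:2509.22214 — 2 statements merged into one kernel-verified Lean document; each statement's English description precedes it below -/
import Mathlib

section
/- Second-order Taylor remainder bound for the feature map (Lemma A.7). In the random features setup with φ Lipschitz with Lipschitz derivative, and with p ≥ d log² d: let x_1 ∈ ℝ^d be a fixed vector with ‖x_1‖_2 = √d. There exist constants c, C > 0 such that with probability at least 1 − 2 exp(−c log² d) over V, the following holds simultaneously for all ε_1, ε_2 ∈ ℝ^d with ‖x_1 + ε_1‖_2 = ‖x_1 + ε_2‖_2 = √d: | (ε_2 − ε_1)ᵀ Vᵀ [ ( φ(V(x_1 + ε_2)) − φ(V(x_1 + ε_1)) ) − φ'(V(x_1 + ε_1)) ∘ ( V(ε_2 − ε_1) ) ] | ≤ C ( p δ³ + d log² d · δ² ), where δ := ‖ε_2 − ε_1‖_2 / √d. -/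
open MeasureTheory ProbabilityTheory Filter

noncomputable section

/-- Euclidean (ℓ²) norm of a vector in `Fin m → ℝ`. -/
def eNorm {m : ℕ} (x : Fin m → ℝ) : ℝ := Real.sqrt (∑ j, (x j) ^ 2)

/-- Euclidean dot product. -/
def dotp {m : ℕ} (u v : Fin m → ℝ) : ℝ := ∑ j, u j * v j

/-- The random-features map `x ↦ (φ(vₖᵀx))ₖ`, where `vₖ` is the `k`-th row of `V`. -/
def featureMap {p d : ℕ} (φ : ℝ → ℝ) (V : Fin p → Fin d → ℝ) (x : Fin d → ℝ) :
    Fin p → ℝ := fun k => φ (dotp (V k) x)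

/-- The `l`-th normalized probabilists' Hermite polynomial (orthonormal in `L²(N(0,1))`). -/
def hermiteFn (l : ℕ) (x : ℝ) : ℝ :=
  (Polynomial.aeval x (Polynomial.hermite l)) / Real.sqrt (Nat.factorial l)

/-- The `l`-th Hermite coefficient `μ_l` of `φ`. -/
def hermiteCoeff (φ : ℝ → ℝ) (l : ℕ) : ℝ :=
  ∫ g, φ g * hermiteFn l g ∂(gaussianReal 0 1)

/-- The nonlinear part of the feature map: `φ̃(x) = (φ(vₖᵀx) − μ₁ vₖᵀx)ₖ`. -/
def tfeatureMap {p d : ℕ} (φ : ℝ → ℝ) (V : Fin p → Fin d → ℝ) (x : Fin d → ℝ) :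
    Fin p → ℝ := fun k => φ (dotp (V k) x) - hermiteCoeff φ 1 * dotp (V k) x

/-- `μ̃² := Σ_{l ≥ 3} μ_l²`. -/
def tmu2 (φ : ℝ → ℝ) : ℝ := ∑' l : ℕ, if 3 ≤ l then (hermiteCoeff φ l) ^ 2 else 0

/-- The law of the random features matrix: i.i.d. entries `N(0, 1/d)`. -/
def gaussianMatrix (p d : ℕ) : Measure (Fin p → Fin d → ℝ) :=
  Measure.pi fun _ => Measure.pi fun _ => gaussianReal 0 ((d : NNReal))⁻¹

/-- Sub-Gaussian norm of a distribution on `ℝ^d`: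
`sup_{‖u‖₂ = 1} inf { t > 0 : E exp((uᵀx)²/t²) ≤ 2 }`. -/
def vecSubGNorm {d : ℕ} (P : Measure (Fin d → ℝ)) : ℝ :=
  ⨆ u : {u : Fin d → ℝ // eNorm u = 1},
    sInf {t : ℝ | 0 < t ∧ ∫ x, Real.exp ((dotp u.1 x) ^ 2 / t ^ 2) ∂P ≤ 2}

/-- Data assumption: `P` is a probability distribution on `ℝ^d` with `‖x‖₂ = √d` a.s.
and sub-Gaussian norm at most `K`. -/
structure DataAssumption {d : ℕ} (P : Measure (Fin d → ℝ)) (K : ℝ) : Prop where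
  prob : IsProbabilityMeasure P
  norm_eq : ∀ᵐ x ∂P, eNorm x = Real.sqrt d
  subg : vecSubGNorm P ≤ K

/-- Core activation assumption: `φ` is non-linear, Lipschitz, with Lipschitz derivative,
`μ₀ = μ₂ = 0` and `μ₁ ≠ 0`. -/
structure ActivationAssumptionCore (φ : ℝ → ℝ) : Prop where
  nonlinear : ¬ ∃ a b : ℝ, ∀ z, φ z = a * z + b
  lipschitz : ∃ L : NNReal, LipschitzWith L φ
  differentiable : Differentiable ℝ φ
  deriv_lipschitz : ∃ L' : NNReal, LipschitzWith L' (deriv φ)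
  mu0 : hermiteCoeff φ 0 = 0
  mu2 : hermiteCoeff φ 2 = 0
  mu1 : hermiteCoeff φ 1 ≠ 0

/-- Full activation assumption: additionally, there are two non-zero Hermite coefficients
of order ≥ 3 with different parity. -/
structure ActivationAssumption (φ : ℝ → ℝ) extends ActivationAssumptionCore φ : Prop where
  parity : ∃ l l' : ℕ, 3 ≤ l ∧ 3 ≤ l' ∧ l % 2 ≠ l' % 2 ∧
    hermiteCoeff φ l ≠ 0 ∧ hermiteCoeff φ l' ≠ 0


open scoped ENNReal NNReal

lemma tr_lint_pi {ι : Type*} [Fintype ι] {E : Type*} [MeasurableSpace E] (μ : ι → Measure E)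
    [∀ i, IsProbabilityMeasure (μ i)] (f : ι → E → ℝ≥0∞) (hf : ∀ i, Measurable (f i)) :
    ∫⁻ x, ∏ i, f i (x i) ∂(Measure.pi μ) = ∏ i, ∫⁻ x, f i x ∂(μ i) := by
  have hind : iIndepFun (fun i (x : ι → E) => f i (x i)) (Measure.pi μ) :=
    iIndepFun_pi (X := f) (fun i => (hf i).aemeasurable)
  rw [lintegral_prod_eq_prod_lintegral_of_indepFun Finset.univ _ hind
    (fun i => (hf i).comp (measurable_pi_apply i))]
  refine Finset.prod_congr rfl fun i _ => ?_
  rw [(measurePreserving_eval μ i).lintegral_comp (hf i)]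

lemma tr_K0 : ∫⁻ g, ENNReal.ofReal (Real.exp (g ^ 2 / 4)) ∂(gaussianReal 0 1) < ∞ := by
  rw [gaussianReal_of_var_ne_zero 0 one_ne_zero,
    lintegral_withDensity_eq_lintegral_mul _ (measurable_gaussianPDF 0 1) (by fun_prop)]
  have : Integrable (fun x : ℝ => gaussianPDFReal 0 1 x * Real.exp (x ^ 2 / 4)) := by
    have h := (integrable_exp_neg_mul_sq (b := 1 / 4) (by norm_num)).const_mul
      (Real.sqrt (2 * Real.pi * (1 : ℝ≥0)))⁻¹
    refine h.congr (Filter.Eventually.of_forall fun x => ?_)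
    simp only [gaussianPDFReal, mul_assoc, ← Real.exp_add]
    congr 2
    simp
    ring
  have h2 := this.lintegral_lt_top
  refine lt_of_le_of_lt (lintegral_mono fun x => ?_) h2
  simp only [Pi.mul_apply, gaussianPDF]
  rw [ENNReal.ofReal_mul (gaussianPDFReal_nonneg _ _ _)]

lemma tr_mgf (v : ℝ≥0) (t : ℝ) :
    ∫⁻ x, ENNReal.ofReal (Real.exp (t * x)) ∂(gaussianReal 0 v) =
      ENNReal.ofReal (Real.exp (v * t ^ 2 / 2)) := by
  rw [← ofReal_integral_eq_lintegral_ofReal (integrable_exp_mul_gaussianReal t)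
    (Filter.Eventually.of_forall fun x => (Real.exp_pos _).le)]
  have := congrFun (mgf_fun_id_gaussianReal (μ := 0) (v := v)) t
  rw [mgf] at this
  rw [this]; simp

lemma tr_mgf_dotp {d : ℕ} (w : Fin d → ℝ) (t : ℝ) :
    ∫⁻ v, ENNReal.ofReal (Real.exp (t * dotp v w))
      ∂(Measure.pi fun _ : Fin d => gaussianReal 0 ((d : NNReal))⁻¹) =
      ENNReal.ofReal (Real.exp (t ^ 2 * ((∑ j, w j ^ 2) / d) / 2)) := by
  have h1 : ∀ v : Fin d → ℝ, ENNReal.ofReal (Real.exp (t * dotp v w)) =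
      ∏ j, ENNReal.ofReal (Real.exp ((t * w j) * v j)) := by
    intro v
    rw [← ENNReal.ofReal_prod_of_nonneg (fun i _ => (Real.exp_pos _).le), ← Real.exp_sum]
    congr 2
    simp only [dotp, Finset.mul_sum]
    exact Finset.sum_congr rfl fun j _ => by ring
  simp_rw [h1]
  rw [tr_lint_pi _ (fun j x => ENNReal.ofReal (Real.exp ((t * w j) * x))) (by fun_prop)]
  simp_rw [tr_mgf]
  rw [← ENNReal.ofReal_prod_of_nonneg (fun i _ => (Real.exp_pos _).le), ← Real.exp_sum]
  congr 2
  push_cast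
  rw [← Finset.sum_div]
  congr 1
  rw [Finset.sum_div, Finset.mul_sum]
  exact Finset.sum_congr rfl fun j _ => by ring

lemma tr_sq {d : ℕ} (hd : 0 < d) (w : Fin d → ℝ) (hw : ∑ j, w j ^ 2 ≤ 4 * d) :
    ∫⁻ v, ENNReal.ofReal (Real.exp ((dotp v w) ^ 2 / 16))
      ∂(Measure.pi fun _ : Fin d => gaussianReal 0 ((d : NNReal))⁻¹) ≤
      ∫⁻ g, ENNReal.ofReal (Real.exp (g ^ 2 / 4)) ∂(gaussianReal 0 1) := by
  have hd' : (0 : ℝ) < d := by exact_mod_cast hd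
  have h8 : (Real.sqrt 8) ^ 2 = 8 := Real.sq_sqrt (by norm_num)
  have h1 : ∀ v : Fin d → ℝ, ENNReal.ofReal (Real.exp ((dotp v w) ^ 2 / 16)) =
      ∫⁻ g, ENNReal.ofReal (Real.exp (g / Real.sqrt 8 * dotp v w)) ∂(gaussianReal 0 1) := by
    intro v
    have := tr_mgf 1 (dotp v w / Real.sqrt 8)
    rw [show (((1 : ℝ≥0) : ℝ) * (dotp v w / Real.sqrt 8) ^ 2 / 2) = (dotp v w) ^ 2 / 16 by
      rw [div_pow, h8]; push_cast; ring] at this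
    rw [← this]
    refine lintegral_congr fun g => ?_
    congr 2
    ring
  simp_rw [h1]
  rw [lintegral_lintegral_swap]
  · refine lintegral_mono fun g => ?_
    rw [tr_mgf_dotp]
    apply ENNReal.ofReal_le_ofReal
    apply Real.exp_le_exp.2
    have : (∑ j, w j ^ 2) / d ≤ 4 := by rw [div_le_iff₀ hd']; exact hw
    rw [div_pow, h8]
    nlinarith [sq_nonneg g]
  · apply Measurable.aemeasurable
    unfold Function.uncurry dotp
    fun_prop

/-- The convex surrogate of `min (δ |y|³) (y²)`. -/
def trG (δ y : ℝ) : ℝ := δ * |y| ^ 3 / (1 + δ * |y|)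

lemma trG_nonneg {δ : ℝ} (hδ : 0 ≤ δ) (y : ℝ) : 0 ≤ trG δ y := by unfold trG; positivity

lemma trG_le_cube {δ : ℝ} (hδ : 0 ≤ δ) (y : ℝ) : trG δ y ≤ δ * |y| ^ 3 := by
  unfold trG
  apply div_le_self (by positivity)
  have : 0 ≤ δ * |y| := by positivity
  linarith

lemma trG_le_sq {δ : ℝ} (hδ : 0 ≤ δ) (y : ℝ) : trG δ y ≤ y ^ 2 := by
  unfold trG
  have : 0 ≤ δ * |y| := by positivity
  rw [div_le_iff₀ (by linarith), ← sq_abs y]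
  nlinarith [sq_nonneg |y|]

lemma trG_mono {δ δ' : ℝ} (hδ : 0 ≤ δ) (h : δ ≤ δ') (y : ℝ) : trG δ y ≤ trG δ' y := by
  unfold trG
  have h1 : 0 ≤ δ * |y| := by positivity
  have h2 : 0 ≤ δ' * |y| := mul_nonneg (hδ.trans h) (abs_nonneg _)
  rw [div_le_div_iff₀ (by linarith) (by linarith)]
  have h3 : 0 ≤ |y| ^ 3 := by positivity
  nlinarith [mul_le_mul_of_nonneg_right h h3]

lemma trF_mid {a b : ℝ} (ha : 0 ≤ a) (hb : 0 ≤ b) :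
    2 * (((a + b) / 2) ^ 3 / (1 + (a + b) / 2)) ≤ a ^ 3 / (1 + a) + b ^ 3 / (1 + b) := by
  have e : ∀ t : ℝ, 0 ≤ t → t ^ 3 / (1 + t) = t ^ 2 - t + 1 - 1 / (1 + t) := by
    intro t ht
    have : 1 + t ≠ 0 := by positivity
    field_simp
    ring
  rw [e _ (by positivity), e a ha, e b hb]
  have key : 1 / (1 + a) + 1 / (1 + b) - 2 * (1 / (1 + (a + b) / 2)) =
      (a - b) ^ 2 / ((1 + a) * (1 + b) * (2 + a + b)) := by
    have h1 : 1 + a ≠ 0 := by positivity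
    have h2 : 1 + b ≠ 0 := by positivity
    have h3 : 2 + a + b ≠ 0 := by positivity
    have h4 : 1 + (a + b) / 2 = (2 + a + b) / 2 := by ring
    rw [h4]
    field_simp
    ring
  have key2 : (a - b) ^ 2 / ((1 + a) * (1 + b) * (2 + a + b)) ≤ (a - b) ^ 2 / 2 := by
    apply div_le_div_of_nonneg_left (sq_nonneg _) (by norm_num)
    have : 1 ≤ (1 + a) * (1 + b) := by nlinarith
    nlinarith
  nlinarith

lemma trF_mono {a b : ℝ} (ha : 0 ≤ a) (hab : a ≤ b) : a ^ 3 / (1 + a) ≤ b ^ 3 / (1 + b) := by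
  have hb := ha.trans hab
  rw [div_le_div_iff₀ (by linarith) (by linarith)]
  have h1 : a ^ 3 ≤ b ^ 3 := by gcongr
  have h2 : a ^ 2 ≤ b ^ 2 := by gcongr
  nlinarith [mul_le_mul_of_nonneg_left h2 (mul_nonneg ha hb)]

lemma trG_mid {δ : ℝ} (hδ : 0 < δ) (y z : ℝ) : 2 * trG δ y ≤ trG δ (y + z) + trG δ (y - z) := by
  have e : ∀ t, trG δ t = ((δ * |t|) ^ 3 / (1 + δ * |t|)) / δ ^ 2 := by
    intro t
    have : 1 + δ * |t| ≠ 0 := by positivity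
    unfold trG
    field_simp
  rw [e, e, e, ← add_div, ← mul_div_assoc]
  apply div_le_div_of_nonneg_right _ (by positivity)
  refine le_trans ?_ (trF_mid (by positivity) (by positivity))
  apply mul_le_mul_of_nonneg_left _ (by norm_num)
  apply trF_mono (by positivity)
  have : 2 * |y| ≤ |y + z| + |y - z| := by
    have := abs_add_le (y + z) (y - z)
    rw [show y + z + (y - z) = 2 * y by ring, abs_mul, abs_two] at this
    exact this
  nlinarith

lemma trG_continuous {δ : ℝ} (hδ : 0 ≤ δ) : Continuous (trG δ) := by
  unfold trG
  refine Continuous.div (by fun_prop) (by fun_prop) fun y => ?_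
  have : 0 ≤ δ * |y| := by positivity
  linarith

lemma trG_exp {δ : ℝ} (hδ : 0 ≤ δ) (y : ℝ) :
    Real.exp (trG δ y / 32) ≤ 1 + 65 * δ * Real.exp (y ^ 2 / 16) := by
  set h := trG δ y / 32 with hh
  have h0 : 0 ≤ h := div_nonneg (trG_nonneg hδ y) (by norm_num)
  have h1 : Real.exp h ≤ 1 + h * Real.exp h := by
    have := Real.add_one_le_exp (-h)
    have h3 : Real.exp (-h) * Real.exp h = 1 := by rw [← Real.exp_add]; simp
    nlinarith [Real.exp_pos h]
  have h2 : Real.exp h ≤ Real.exp (y ^ 2 / 32) := by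
    apply Real.exp_le_exp.2; rw [hh]; linarith [trG_le_sq hδ y]
  have h3 : |y| ^ 3 ≤ 2049 * Real.exp (y ^ 2 / 32) := by
    have e1 := Real.quadratic_le_exp_of_nonneg (x := y ^ 2 / 32) (by positivity)
    have e2 : |y| ^ 3 ≤ 1 + y ^ 4 := by
      rw [show y ^ 4 = |y| ^ 4 by rw [← abs_pow, abs_of_nonneg (by positivity)]]
      have := abs_nonneg y
      rcases le_total |y| 1 with hy | hy
      · have : |y| ^ 3 ≤ 1 := pow_le_one₀ this hy
        have : 0 ≤ |y| ^ 4 := by positivity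
        linarith
      · have : |y| ^ 3 ≤ |y| ^ 4 := pow_le_pow_right₀ hy (by norm_num)
        linarith
    nlinarith [sq_nonneg y]
  have h4 : h ≤ 65 * δ * Real.exp (y ^ 2 / 32) := by
    have := trG_le_cube hδ y
    have h5 := mul_le_mul_of_nonneg_left h3 hδ
    have : 0 ≤ δ * Real.exp (y ^ 2 / 32) := by positivity
    rw [hh]; linarith
  have h5 : Real.exp (y ^ 2 / 16) = Real.exp (y ^ 2 / 32) * Real.exp (y ^ 2 / 32) := by
    rw [← Real.exp_add]; congr 1; ring
  rw [h5]
  have := mul_le_mul h4 h2 (Real.exp_pos _).le (by positivity)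
  linarith

lemma tr_row {d : ℕ} (hd : 0 < d) (w : Fin d → ℝ) (hw : ∑ j, w j ^ 2 ≤ 4 * d) {δ : ℝ}
    (hδ : 0 ≤ δ) :
    ∫⁻ v, ENNReal.ofReal (Real.exp (trG δ (dotp v w) / 32))
      ∂(Measure.pi fun _ : Fin d => gaussianReal 0 ((d : NNReal))⁻¹) ≤
    ENNReal.ofReal (Real.exp (65 *
      (∫⁻ g, ENNReal.ofReal (Real.exp (g ^ 2 / 4)) ∂(gaussianReal 0 1)).toReal * δ)) := by
  set K := ∫⁻ g, ENNReal.ofReal (Real.exp (g ^ 2 / 4)) ∂(gaussianReal 0 1)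
  calc _ ≤ ∫⁻ v, (1 + ENNReal.ofReal (65 * δ) * ENNReal.ofReal (Real.exp ((dotp v w) ^ 2 / 16)))
      ∂(Measure.pi fun _ : Fin d => gaussianReal 0 ((d : NNReal))⁻¹) := by
        refine lintegral_mono fun v => ?_
        rw [← ENNReal.ofReal_mul (by positivity), ← ENNReal.ofReal_one,
          ← ENNReal.ofReal_add (by positivity) (by positivity)]
        exact ENNReal.ofReal_le_ofReal (trG_exp hδ _)
    _ ≤ 1 + ENNReal.ofReal (65 * δ) * K := by
        rw [lintegral_add_left (by fun_prop), lintegral_const_mul' _ _ ENNReal.ofReal_ne_top]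
        simp only [lintegral_const, measure_univ, mul_one]
        gcongr
        exact tr_sq hd w hw
    _ = ENNReal.ofReal (1 + 65 * δ * K.toReal) := by
        rw [ENNReal.ofReal_add (by positivity) (by positivity),
          ENNReal.ofReal_mul (p := 65 * δ) (by positivity), ENNReal.ofReal_toReal tr_K0.ne,
          ENNReal.ofReal_one]
    _ ≤ _ := by
        apply ENNReal.ofReal_le_ofReal
        have := Real.add_one_le_exp (65 * K.toReal * δ)
        linarith

instance (p d : ℕ) : IsProbabilityMeasure (gaussianMatrix p d) := by
  unfold gaussianMatrix; infer_instance

lemma tr_rows {p d : ℕ} (hd : 0 < d) (w : Fin d → ℝ) (hw : ∑ j, w j ^ 2 ≤ 4 * d) {δ : ℝ}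
    (hδ : 0 ≤ δ) :
    ∫⁻ V, ENNReal.ofReal (Real.exp (∑ k, trG δ (dotp (V k) w) / 32)) ∂(gaussianMatrix p d) ≤
    ENNReal.ofReal (Real.exp (65 *
      (∫⁻ g, ENNReal.ofReal (Real.exp (g ^ 2 / 4)) ∂(gaussianReal 0 1)).toReal * (p * δ))) := by
  have h1 : ∀ V : Fin p → Fin d → ℝ,
      ENNReal.ofReal (Real.exp (∑ k, trG δ (dotp (V k) w) / 32)) =
      ∏ k, ENNReal.ofReal (Real.exp (trG δ (dotp (V k) w) / 32)) := by
    intro V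
    rw [← ENNReal.ofReal_prod_of_nonneg (fun i _ => (Real.exp_pos _).le), ← Real.exp_sum]
  simp_rw [h1]
  unfold gaussianMatrix
  rw [tr_lint_pi _ (fun _ v => ENNReal.ofReal (Real.exp (trG δ (dotp v w) / 32)))]
  · refine (Finset.prod_le_prod' fun k _ => tr_row hd w hw hδ).trans ?_
    rw [Finset.prod_const, ← ENNReal.ofReal_pow (Real.exp_pos _).le, ← Real.exp_nat_mul]
    simp only [Finset.card_univ, Fintype.card_fin]
    apply le_of_eq
    congr 2
    ring
  · intro _
    have := (trG_continuous hδ).measurable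
    unfold dotp
    fun_prop

lemma tr_avg {d : ℕ} (f : EuclideanSpace ℝ (Fin d) → ℝ≥0∞) (hf : Measurable f)
    (hmid : ∀ w z, 2 * f w ≤ f (w + z) + f (w - z)) {R : ℝ} (w : EuclideanSpace ℝ (Fin d))
    (hw : ‖w‖ ≤ R) :
    f w * volume (Metric.closedBall (0 : EuclideanSpace ℝ (Fin d)) R) ≤
      ∫⁻ z in Metric.closedBall (0 : EuclideanSpace ℝ (Fin d)) (2 * R), f z := by
  set B := Metric.closedBall (0 : EuclideanSpace ℝ (Fin d)) R
  set B2 := Metric.closedBall (0 : EuclideanSpace ℝ (Fin d)) (2 * R)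
  have hB2 : MeasurableSet B2 := Metric.isClosed_closedBall.measurableSet
  have hB : MeasurableSet B := Metric.isClosed_closedBall.measurableSet
  have i1 : ∫⁻ z in B, f (w + z) ≤ ∫⁻ z in B2, f z := by
    rw [← lintegral_indicator hB2, ← lintegral_add_left_eq_self (B2.indicator f) w]
    refine le_trans (setLIntegral_mono' (g := fun z => B2.indicator f (w + z)) hB fun z hz => ?_)
      (setLIntegral_le_lintegral _ _)
    have : w + z ∈ B2 := by
      simp only [B, B2, mem_closedBall_zero_iff] at hz ⊢
      linarith [norm_add_le w z]
    rw [Set.indicator_of_mem this]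
  have i2 : ∫⁻ z in B, f (w - z) ≤ ∫⁻ z in B2, f z := by
    rw [← lintegral_indicator hB2, ← lintegral_sub_left_eq_self (B2.indicator f) w]
    refine le_trans (setLIntegral_mono' (g := fun z => B2.indicator f (w - z)) hB fun z hz => ?_)
      (setLIntegral_le_lintegral _ _)
    have : w - z ∈ B2 := by
      simp only [B, B2, mem_closedBall_zero_iff] at hz ⊢
      linarith [norm_sub_le w z]
    rw [Set.indicator_of_mem this]
  have i3 : 2 * (f w * volume B) ≤ 2 * ∫⁻ z in B2, f z := by
    calc 2 * (f w * volume B) = ∫⁻ _ in B, 2 * f w := by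
          rw [setLIntegral_const, mul_assoc]
      _ ≤ ∫⁻ z in B, (f (w + z) + f (w - z)) := lintegral_mono fun z => hmid w z
      _ = (∫⁻ z in B, f (w + z)) + ∫⁻ z in B, f (w - z) :=
          lintegral_add_left (by fun_prop) _
      _ ≤ _ := by rw [two_mul]; exact add_le_add i1 i2
  exact (ENNReal.mul_le_mul_iff_right (by norm_num) (by norm_num)).1 i3

lemma tr_sup {p d : ℕ} (hd : 0 < d) {δ : ℝ} (hδ : 0 < δ) (t : ℝ) :
    gaussianMatrix p d {V | ∃ w : EuclideanSpace ℝ (Fin d), ‖w‖ ≤ Real.sqrt d ∧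
      32 * (d * Real.log 2 + 65 * (∫⁻ g, ENNReal.ofReal (Real.exp (g ^ 2 / 4))
        ∂(gaussianReal 0 1)).toReal * (p * δ) + t) ≤ ∑ k, trG δ (dotp (V k) w.ofLp)} ≤
      ENNReal.ofReal (Real.exp (-t)) := by
  have hd' : (0 : ℝ) < d := by exact_mod_cast hd
  set K := 65 * (∫⁻ g, ENNReal.ofReal (Real.exp (g ^ 2 / 4))
        ∂(gaussianReal 0 1)).toReal * (p * δ) with hK
  set R := Real.sqrt d with hR
  have hRpos : 0 < R := Real.sqrt_pos.2 hd'
  set f : (Fin p → Fin d → ℝ) → EuclideanSpace ℝ (Fin d) → ℝ≥0∞ := fun V w =>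
    ENNReal.ofReal (Real.exp (∑ k, trG δ (dotp (V k) w.ofLp) / 32)) with hf
  have hfm : Measurable (Function.uncurry f) := by
    have h1 := (trG_continuous hδ.le).measurable
    have h2 : ∀ k : Fin p, Continuous fun x : (Fin p → Fin d → ℝ) × EuclideanSpace ℝ (Fin d) =>
        dotp (x.1 k) x.2.ofLp := by
      intro k; unfold dotp; fun_prop
    have h3 := fun k => (h2 k).measurable
    unfold Function.uncurry
    simp only [hf]
    fun_prop
  have hmid : ∀ V w z, 2 * f V w ≤ f V (w + z) + f V (w - z) := by
    intro V w z
    simp only [hf]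
    have two_ofReal : ∀ x : ℝ, 2 * ENNReal.ofReal x = ENNReal.ofReal (2 * x) := by
      intro x
      rw [ENNReal.ofReal_mul (by norm_num)]; simp
    rw [← ENNReal.ofReal_add (Real.exp_pos _).le (Real.exp_pos _).le, two_ofReal]
    apply ENNReal.ofReal_le_ofReal
    set a := ∑ k, trG δ (dotp (V k) w.ofLp) / 32
    set b := ∑ k, trG δ (dotp (V k) (w + z).ofLp) / 32 with hb
    set c := ∑ k, trG δ (dotp (V k) (w - z).ofLp) / 32 with hc
    have habc : 2 * a ≤ b + c := by
      rw [hb, hc, ← Finset.sum_add_distrib, Finset.mul_sum]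
      refine Finset.sum_le_sum fun k _ => ?_
      have := trG_mid hδ (dotp (V k) w.ofLp) (dotp (V k) z.ofLp)
      have e1 : dotp (V k) (w + z).ofLp = dotp (V k) w.ofLp + dotp (V k) z.ofLp := by
        simp [dotp, mul_add, Finset.sum_add_distrib]
      have e2 : dotp (V k) (w - z).ofLp = dotp (V k) w.ofLp - dotp (V k) z.ofLp := by
        simp [dotp, mul_sub, Finset.sum_sub_distrib]
      rw [e1, e2]
      linarith
    have e1 : Real.exp a ≤ Real.exp ((b + c) / 2) := Real.exp_le_exp.2 (by linarith)
    have e2 : Real.exp b = Real.exp (b / 2) ^ 2 := by rw [sq, ← Real.exp_add]; congr 1; ring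
    have e3 : Real.exp c = Real.exp (c / 2) ^ 2 := by rw [sq, ← Real.exp_add]; congr 1; ring
    have e4 : Real.exp ((b + c) / 2) = Real.exp (b / 2) * Real.exp (c / 2) := by
      rw [← Real.exp_add]; congr 1; ring
    rw [e2, e3]
    nlinarith [sq_nonneg (Real.exp (b / 2) - Real.exp (c / 2))]
  set B := Metric.closedBall (0 : EuclideanSpace ℝ (Fin d)) R
  set B2 := Metric.closedBall (0 : EuclideanSpace ℝ (Fin d)) (2 * R) with hB2d
  have hB2 : MeasurableSet B2 := Metric.isClosed_closedBall.measurableSet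
  have hvol : volume B2 = ENNReal.ofReal (2 ^ d) * volume B := by
    rw [hB2d, Measure.addHaar_closedBall_mul _ _ (by norm_num) hRpos.le]
    simp
    rfl
  have hBpos : volume B ≠ 0 := (Metric.measure_closedBall_pos _ _ hRpos).ne'
  have hBtop : volume B ≠ ∞ := measure_closedBall_lt_top.ne
  set Φ : (Fin p → Fin d → ℝ) → ℝ≥0∞ := fun V => ∫⁻ w in B2, f V w with hΦ
  have hΦm : Measurable Φ := Measurable.lintegral_prod_right' hfm
  have hEΦ : ∫⁻ V, Φ V ∂(gaussianMatrix p d) ≤ ENNReal.ofReal (Real.exp K) * volume B2 := by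
    rw [hΦ, lintegral_lintegral_swap hfm.aemeasurable]
    rw [← setLIntegral_const]
    refine setLIntegral_mono' hB2 fun w hw => ?_
    refine tr_rows hd w.ofLp ?_ hδ.le
    rw [← EuclideanSpace.real_norm_sq_eq]
    simp only [hB2d, mem_closedBall_zero_iff] at hw
    have hsq : R ^ 2 = d := Real.sq_sqrt hd'.le
    nlinarith [norm_nonneg w]
  set M : ℝ≥0∞ := ENNReal.ofReal (Real.exp (d * Real.log 2 + K + t)) * volume B with hM
  have hM0 : M ≠ 0 := mul_ne_zero (by simpa using Real.exp_pos _) hBpos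
  have hMtop : M ≠ ∞ := ENNReal.mul_ne_top ENNReal.ofReal_ne_top hBtop
  have hmk := mul_meas_ge_le_lintegral (μ := gaussianMatrix p d) hΦm M
  have hMeq : ENNReal.ofReal (Real.exp K) * volume B2 = M * ENNReal.ofReal (Real.exp (-t)) := by
    rw [hvol, hM, ← mul_assoc,
      mul_right_comm (ENNReal.ofReal (Real.exp (d * Real.log 2 + K + t))), ← ENNReal.ofReal_mul (Real.exp_pos _).le,
      ← ENNReal.ofReal_mul (Real.exp_pos _).le, ← Real.exp_add]
    congr 2
    rw [show (d : ℝ) * Real.log 2 + K + t + -t = K + d * Real.log 2 by ring, Real.exp_add,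
      Real.exp_nat_mul, Real.exp_log (by norm_num)]
  have hlast : gaussianMatrix p d {V | M ≤ Φ V} ≤ ENNReal.ofReal (Real.exp (-t)) :=
    (ENNReal.mul_le_mul_iff_right hM0 hMtop).1 ((hmk.trans hEΦ).trans_eq hMeq)
  refine (measure_mono ?_).trans hlast
  rintro V ⟨w, hw, hle⟩
  refine le_trans ?_ (tr_avg (f V) (hfm.of_uncurry_left) (hmid V) w hw)
  rw [hM]
  gcongr
  apply ENNReal.ofReal_le_ofReal
  apply Real.exp_le_exp.2
  rw [← Finset.sum_div, le_div_iff₀ (by norm_num)]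
  linarith

lemma tr_taylor (φ : ℝ → ℝ) {L L' : ℝ≥0} (hL : LipschitzWith L φ) (hdiff : Differentiable ℝ φ)
    (hL' : LipschitzWith L' (deriv φ)) (z a : ℝ) :
    |a * (φ (z + a) - φ z - deriv φ z * a)| ≤ 2 * (2 * L + L') * trG 1 a := by
  have hb : ∀ C : ℝ, (∀ x ∈ Set.Icc (z - |a|) (z + |a|), |deriv φ x - deriv φ z| ≤ C) →
      |φ (z + a) - φ z - deriv φ z * a| ≤ C * |a| := by
    intro C hC
    have h := (convex_Icc (z - |a|) (z + |a|)).norm_image_sub_le_of_norm_hasDerivWithin_le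
      (f := fun x => φ x - deriv φ z * x) (f' := fun x => deriv φ x - deriv φ z) (C := C)
      (x := z) (y := z + a) (fun x _ => by
        have h1 := (hdiff x).hasDerivAt
        have h2 := (hasDerivAt_id x).const_mul (deriv φ z)
        simpa using (h1.fun_sub h2).hasDerivWithinAt) hC
      ⟨by linarith [abs_nonneg a], by linarith [abs_nonneg a]⟩
      ⟨by linarith [neg_abs_le a], by linarith [le_abs_self a]⟩
    simp only [Real.norm_eq_abs] at h
    rw [show z + a - z = a by ring] at h
    rwa [show φ (z + a) - deriv φ z * (z + a) - (φ z - deriv φ z * z) =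
      φ (z + a) - φ z - deriv φ z * a by ring] at h
  have h1 := hb (2 * L) fun x _ => by
    have e1 := norm_deriv_le_of_lipschitz (x₀ := x) hL
    have e2 := norm_deriv_le_of_lipschitz (x₀ := z) hL
    rw [Real.norm_eq_abs] at e1 e2
    have := abs_sub (deriv φ x) (deriv φ z)
    linarith
  have h2 := hb (L' * |a|) fun x hx => by
    have := hL'.dist_le_mul x z
    rw [Real.dist_eq, Real.dist_eq] at this
    have h3 : |x - z| ≤ |a| := abs_le.2 ⟨by linarith [hx.1], by linarith [hx.2]⟩
    exact this.trans (mul_le_mul_of_nonneg_left h3 L'.2)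
  rw [abs_mul]
  set r := |φ (z + a) - φ z - deriv φ z * a|
  have ha := abs_nonneg a
  have hL0 : (0 : ℝ) ≤ L := L.2
  have hL0' : (0 : ℝ) ≤ L' := L'.2
  unfold trG
  rw [one_mul, one_mul, ← mul_div_assoc, le_div_iff₀ (by linarith)]
  rcases le_total |a| 1 with h | h
  · have : r * (1 + |a|) ≤ (L' * |a| * |a|) * 2 :=
      mul_le_mul h2 (by linarith) (by linarith) (by positivity)
    calc |a| * r * (1 + |a|) = |a| * (r * (1 + |a|)) := by ring
      _ ≤ |a| * ((L' * |a| * |a|) * 2) := mul_le_mul_of_nonneg_left this ha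
      _ = 2 * L' * |a| ^ 3 := by ring
      _ ≤ 2 * (2 * L + L') * |a| ^ 3 := by gcongr; linarith
  · have : r * (1 + |a|) ≤ (2 * L * |a|) * (2 * |a|) :=
      mul_le_mul h1 (by linarith) (by linarith) (by positivity)
    calc |a| * r * (1 + |a|) = |a| * (r * (1 + |a|)) := by ring
      _ ≤ |a| * ((2 * L * |a|) * (2 * |a|)) := mul_le_mul_of_nonneg_left this ha
      _ = 2 * (2 * L) * |a| ^ 3 := by ring
      _ ≤ 2 * (2 * L + L') * |a| ^ 3 := by gcongr; linarith

/-- **Lemma A.7 (Second-order Taylor remainder bound for the feature map).**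
For `φ` Lipschitz with Lipschitz derivative and `p ≥ d log² d`: for any fixed `x₁` with
`‖x₁‖₂ = √d`, there are constants `c, C > 0` such that with probability at least
`1 − 2 exp(−c log² d)` over `V`, simultaneously for all `ε₁, ε₂` with
`‖x₁+ε₁‖₂ = ‖x₁+ε₂‖₂ = √d`:
`|(ε₂−ε₁)ᵀVᵀ[(φ(V(x₁+ε₂)) − φ(V(x₁+ε₁))) − φ'(V(x₁+ε₁)) ∘ (V(ε₂−ε₁))]|
  ≤ C (p δ³ + d log² d · δ²)` with `δ = ‖ε₂−ε₁‖₂/√d`. -/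
theorem taylor_remainder_feature_map
    (φ : ℝ → ℝ) (hLip : ∃ L : NNReal, LipschitzWith L φ)
    (hdiff : Differentiable ℝ φ) (hLip' : ∃ L' : NNReal, LipschitzWith L' (deriv φ)) :
    ∃ c : ℝ, 0 < c ∧ ∃ C : ℝ, 0 < C ∧
      ∀ (p d : ℕ), (d : ℝ) * (Real.log d) ^ 2 ≤ p →
        ∀ x₁ : Fin d → ℝ, eNorm x₁ = Real.sqrt d →
          1 - ENNReal.ofReal (2 * Real.exp (-c * (Real.log d) ^ 2)) ≤
            gaussianMatrix p d
              {V | ∀ ε₁ ε₂ : Fin d → ℝ,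
                eNorm (x₁ + ε₁) = Real.sqrt d → eNorm (x₁ + ε₂) = Real.sqrt d →
                |dotp (fun k => dotp (V k) (ε₂ - ε₁))
                    (fun k => (featureMap φ V (x₁ + ε₂) k - featureMap φ V (x₁ + ε₁) k) -
                      deriv φ (dotp (V k) (x₁ + ε₁)) * dotp (V k) (ε₂ - ε₁))| ≤
                  C * ((p : ℝ) * (eNorm (ε₂ - ε₁) / Real.sqrt d) ^ 3 +
                    (d : ℝ) * (Real.log d) ^ 2 * (eNorm (ε₂ - ε₁) / Real.sqrt d) ^ 2)} := by
  obtain ⟨L, hL⟩ := hLip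
  obtain ⟨L', hL'⟩ := hLip'
  set K := 65 * (∫⁻ g, ENNReal.ofReal (Real.exp (g ^ 2 / 4)) ∂(gaussianReal 0 1)).toReal with hK
  have hK0 : 0 ≤ K := by positivity
  set D : ℝ := 32 * (3 + K) with hD
  have hD0 : 0 ≤ D := by positivity
  set Q : ℝ := 2 * (2 * L + L') with hQ
  have hQ0 : 0 ≤ Q := by positivity
  refine ⟨1, one_pos, Q * D * 2 + 1, by positivity, ?_⟩
  intro p d hp x₁ _
  rcases lt_or_ge d 2 with hd | hd
  · have hlog : Real.log d = 0 := by
      interval_cases d <;> simp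
    rw [hlog]
    refine le_trans (le_of_eq ?_) (zero_le)
    rw [tsub_eq_zero_iff_le]
    simp
  have hdpos : 0 < d := by omega
  have hd2 : (2 : ℝ) ≤ d := by exact_mod_cast hd
  have hd' : (0 : ℝ) < d := by linarith
  have hlog2 := Real.log_two_gt_d9
  have hlogd : Real.log 2 ≤ Real.log d := Real.log_le_log (by norm_num) hd2
  set ℓ := Real.log d with hℓ
  set A : ℝ := d * ℓ ^ 2 with hA
  have hA1 : d * Real.log 2 ≤ 2 * A := by
    have : Real.log 2 ≤ 2 * ℓ ^ 2 := by nlinarith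
    nlinarith
  have hA2 : Real.log 2 ≤ A := by
    have : Real.log 2 * 2 ≤ d * Real.log 2 := by nlinarith
    linarith
  have hA3 : ℓ ^ 2 ≤ A := by nlinarith [sq_nonneg ℓ]
  have hApos : 0 < A := by linarith
  have hp0 : (0 : ℝ) < p := by linarith
  set bad : ℕ → Set (Fin p → Fin d → ℝ) := fun j =>
    {V | ∃ w : EuclideanSpace ℝ (Fin d), ‖w‖ ≤ Real.sqrt d ∧
      32 * (d * Real.log 2 + K * (p * (A / p * 2 ^ j)) + A * 2 ^ j) ≤
        ∑ k, trG (A / p * 2 ^ j) (dotp (V k) w.ofLp)} with hbad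
  have hbadm : ∀ j, gaussianMatrix p d (bad j) ≤
      ENNReal.ofReal (Real.exp (-A)) * (2 : ℝ≥0∞)⁻¹ ^ j := by
    intro j
    refine (tr_sup (p := p) hdpos (δ := A / p * 2 ^ j) (by positivity) (A * 2 ^ j)).trans ?_
    have e1 : (2 : ℝ≥0∞)⁻¹ ^ j = ENNReal.ofReal ((2⁻¹ : ℝ) ^ j) := by
      rw [ENNReal.ofReal_pow (by norm_num), ENNReal.ofReal_inv_of_pos (by norm_num)]
      simp
    rw [e1, ← ENNReal.ofReal_mul (Real.exp_pos _).le]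
    apply ENNReal.ofReal_le_ofReal
    have e2 : (2⁻¹ : ℝ) ^ j = Real.exp (-(j * Real.log 2)) := by
      rw [Real.exp_neg, Real.exp_nat_mul, Real.exp_log (by norm_num), inv_pow]
    rw [e2, ← Real.exp_add]
    apply Real.exp_le_exp.2
    have e3 : (1 + j : ℝ) ≤ 2 ^ j := by
      have := one_add_mul_le_pow (a := (1 : ℝ)) (by norm_num) j
      norm_num at this
      exact this
    have e4 : (0 : ℝ) ≤ j := Nat.cast_nonneg j
    nlinarith [mul_le_mul_of_nonneg_left e3 hApos.le, mul_le_mul_of_nonneg_left hA2 e4]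
  have hbadU : gaussianMatrix p d (⋃ j, bad j) ≤
      ENNReal.ofReal (2 * Real.exp (-1 * ℓ ^ 2)) := by
    refine (measure_iUnion_le _).trans ((ENNReal.tsum_le_tsum hbadm).trans ?_)
    rw [ENNReal.tsum_mul_left, ENNReal.tsum_geometric, ENNReal.one_sub_inv_two, inv_inv,
      mul_comm 2, ENNReal.ofReal_mul (Real.exp_pos _).le]
    simp only [ENNReal.ofReal_ofNat]
    gcongr
    linarith
  rw [tsub_le_iff_right]
  refine le_trans ?_ (add_le_add_right hbadU _)
  rw [← measure_univ (μ := gaussianMatrix p d)]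
  refine le_trans (measure_mono ?_) (measure_union_le _ _)
  intro V _
  by_cases hV : V ∈ ⋃ j, bad j
  · exact Or.inr hV
  refine Or.inl ?_
  intro ε₁ ε₂ _ _
  have hgood : ∀ (j : ℕ) (w : EuclideanSpace ℝ (Fin d)), ‖w‖ ≤ Real.sqrt d →
      ∑ k, trG (A / p * 2 ^ j) (dotp (V k) w.ofLp) ≤ D * (A * 2 ^ j) := by
    intro j w hw
    by_contra hcon
    push Not at hcon
    apply hV
    refine Set.mem_iUnion.2 ⟨j, w, hw, le_trans ?_ hcon.le⟩
    have h1 : (p : ℝ) * (A / p * 2 ^ j) = A * 2 ^ j := by field_simp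
    rw [h1, hD]
    have h2 : A ≤ A * 2 ^ j := le_mul_of_one_le_right hApos.le (one_le_pow₀ (by norm_num))
    nlinarith
  set u := ε₂ - ε₁ with hu
  set δ := eNorm u / Real.sqrt d with hδ
  have hsd : 0 < Real.sqrt d := Real.sqrt_pos.2 hd'
  have hlhs : |dotp (fun k => dotp (V k) u)
      (fun k => (featureMap φ V (x₁ + ε₂) k - featureMap φ V (x₁ + ε₁) k) -
        deriv φ (dotp (V k) (x₁ + ε₁)) * dotp (V k) u)| ≤
      Q * ∑ k, trG 1 (dotp (V k) u) := by
    rw [dotp, Finset.mul_sum]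
    refine (Finset.abs_sum_le_sum_abs _ _).trans (Finset.sum_le_sum fun k _ => ?_)
    have := tr_taylor φ hL hdiff hL' (dotp (V k) (x₁ + ε₁)) (dotp (V k) u)
    have e : dotp (V k) (x₁ + ε₁) + dotp (V k) u = dotp (V k) (x₁ + ε₂) := by
      simp only [dotp, hu, ← Finset.sum_add_distrib, ← mul_add]
      refine Finset.sum_congr rfl fun j _ => ?_
      simp only [Pi.add_apply, Pi.sub_apply]
      ring
    rw [e] at this
    exact this
  refine hlhs.trans ?_
  have hδ0 : 0 ≤ δ := div_nonneg (Real.sqrt_nonneg _) hsd.le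
  rcases hδ0.eq_or_lt with hz | hpos
  · have hu0 : eNorm u = 0 := by
      have := hz.symm
      rw [hδ, div_eq_zero_iff] at this
      exact this.resolve_right hsd.ne'
    have hu1 : ∑ j, (u j) ^ 2 = 0 :=
      (Real.sqrt_eq_zero (Finset.sum_nonneg fun j _ => sq_nonneg _)).1 hu0
    have hu2 : ∀ j, u j = 0 := by
      intro j
      have := (Finset.sum_eq_zero_iff_of_nonneg (fun j _ => sq_nonneg (u j))).1 hu1 j
        (Finset.mem_univ _)
      exact pow_eq_zero_iff (two_ne_zero) |>.1 this
    have hu3 : ∀ k, dotp (V k) u = 0 := by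
      intro k
      simp [dotp, hu2]
    simp [hu3, trG, ← hz]
  set w : EuclideanSpace ℝ (Fin d) := WithLp.toLp 2 (δ⁻¹ • u) with hw
  have hwn : ‖w‖ ≤ Real.sqrt d := by
    have h1 : w = δ⁻¹ • WithLp.toLp 2 u := rfl
    have h2 : ‖(WithLp.toLp 2 u : EuclideanSpace ℝ (Fin d))‖ = eNorm u := by
      rw [EuclideanSpace.norm_eq]
      simp [eNorm]
    have h3 : eNorm u = δ * Real.sqrt d := by rw [hδ]; field_simp
    rw [h1, norm_smul, h2, h3, Real.norm_eq_abs, abs_of_pos (inv_pos.2 hpos)]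
    apply le_of_eq
    field_simp
  have hy : ∀ k, dotp (V k) u = δ * dotp (V k) w.ofLp := by
    intro k
    simp only [dotp, hw, Finset.mul_sum, Pi.smul_apply, smul_eq_mul]
    refine Finset.sum_congr rfl fun j _ => ?_
    field_simp
  have hscale : ∀ y, trG 1 (δ * y) = δ ^ 2 * trG δ y := by
    intro y
    have : 1 + δ * |y| ≠ 0 := by positivity
    unfold trG
    rw [abs_mul, abs_of_pos hpos, one_mul, one_mul]
    field_simp
  have hmain : ∀ j : ℕ, δ ≤ A / p * 2 ^ j →
      ∑ k, trG 1 (dotp (V k) u) ≤ δ ^ 2 * (D * (A * 2 ^ j)) := by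
    intro j hj
    simp_rw [hy, hscale]
    rw [← Finset.mul_sum]
    refine mul_le_mul_of_nonneg_left ?_ (sq_nonneg _)
    exact (Finset.sum_le_sum fun k _ => trG_mono hδ0 hj _).trans (hgood j w hwn)
  have hfin : ∑ k, trG 1 (dotp (V k) u) ≤ D * 2 * (p * δ ^ 3 + A * δ ^ 2) := by
    have hpd : 0 ≤ (p : ℝ) * δ ^ 3 := by positivity
    have hAd : 0 ≤ A * δ ^ 2 := by positivity
    have hDp := mul_nonneg hD0 hpd
    have hDA := mul_nonneg hD0 hAd
    rcases le_total δ (A / p) with hle | hle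
    · have := hmain 0 (by simpa using hle)
      rw [pow_zero, mul_one] at this
      have h4 : δ ^ 2 * (D * A) = D * (A * δ ^ 2) := by ring
      have h5 : D * 2 * (p * δ ^ 3 + A * δ ^ 2) =
          2 * (D * (p * δ ^ 3)) + 2 * (D * (A * δ ^ 2)) := by ring
      linarith
    · obtain ⟨n, hn1, hn2⟩ := exists_nat_pow_near (x := δ / (A / p)) (y := 2)
        ((one_le_div (by positivity)).2 hle) (by norm_num)
      rw [div_lt_iff₀ (by positivity)] at hn2
      rw [le_div_iff₀ (by positivity)] at hn1
      have h1 := hmain (n + 1) (by linarith)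
      have h2 : A * 2 ^ (n + 1) ≤ 2 * (p * δ) := by
        have : A * 2 ^ (n + 1) = 2 * (p * (2 ^ n * (A / p))) := by
          rw [pow_succ]; field_simp
        rw [this]
        gcongr
      have h3 : δ ^ 2 * (D * (A * 2 ^ (n + 1))) ≤ δ ^ 2 * (D * (2 * (p * δ))) := by gcongr
      have h4 : δ ^ 2 * (D * (2 * (p * δ))) = 2 * (D * (p * δ ^ 3)) := by ring
      have h5 : D * 2 * (p * δ ^ 3 + A * δ ^ 2) =
          2 * (D * (p * δ ^ 3)) + 2 * (D * (A * δ ^ 2)) := by ring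
      linarith
  have hX : 0 ≤ (p : ℝ) * δ ^ 3 + A * δ ^ 2 := by positivity
  have := mul_le_mul_of_nonneg_left hfin hQ0
  have h6 : (Q * D * 2 + 1) * ((p : ℝ) * δ ^ 3 + A * δ ^ 2) =
      Q * (D * 2 * (p * δ ^ 3 + A * δ ^ 2)) + (p * δ ^ 3 + A * δ ^ 2) := by ring
  rw [h6]
  linarith
end
end

section
/- Alignment of the first-order feature increment (Lemma A.8). In the random features setup with φ Lipschitz with Lipschitz derivative and first Hermite coefficient μ_1, along a sequence of problems with p = p(d) satisfying p/(d log² d) → ∞: for every η > 0 there exist constants ε₀ > 0, c > 0 and D such that for all d ≥ D and every fixed x_1 ∈ ℝ^d with ‖x_1‖_2 = √d, with probability at least 1 − 2 exp(−c log² d) over V, the following holds simultaneously for all ε_1, ε_2 ∈ ℝ^d with ‖x_1 + ε_1‖_2 = ‖x_1 + ε_2‖_2 = √d and max(‖ε_1‖_2, ‖ε_2‖_2) ≤ ε₀ √d: | (ε_2 − ε_1)ᵀ Vᵀ ( φ'(V(x_1 + ε_1)) ∘ ( V(ε_2 − ε_1) ) ) − (‖ε_2 − ε_1‖_2² / d)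 p μ_1 | ≤ η p δ², where δ := ‖ε_2 − ε_1‖_2 / √d. -/
open MeasureTheory ProbabilityTheory Filter

noncomputable section

/-- Law of one row. -/
def rowMeasure (d : ℕ) : Measure (Fin d → ℝ) :=
  Measure.pi fun _ => gaussianReal 0 ((d : NNReal))⁻¹

instance rowMeasure_prob (d : ℕ) : IsProbabilityMeasure (rowMeasure d) := by
  unfold rowMeasure; infer_instance

instance gaussianMatrix_prob (p d : ℕ) : IsProbabilityMeasure (gaussianMatrix p d) := by
  unfold gaussianMatrix; infer_instance

lemma gaussianMatrix_eq (p d : ℕ) : gaussianMatrix p d = Measure.pi fun _ => rowMeasure d := rfl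

lemma measurable_dotp {d : ℕ} (z : Fin d → ℝ) : Measurable (fun v : Fin d → ℝ => dotp v z) := by
  unfold dotp; fun_prop

lemma rowMeasure_charFun {d : ℕ} (z : Fin d → ℝ) :
    ∫ v, Complex.exp ((dotp v z : ℝ) * Complex.I) ∂(rowMeasure d)
      = Complex.exp (-((∑ j, z j ^ 2) / d / 2 : ℝ)) := by
  have h1 : ∀ v : Fin d → ℝ, Complex.exp ((dotp v z : ℝ) * Complex.I)
      = ∏ j, Complex.exp (z j * v j * Complex.I) := by
    intro v
    rw [← Complex.exp_sum, dotp, Complex.ofReal_sum, Finset.sum_mul]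
    congr 1
    refine Finset.sum_congr rfl fun j _ => ?_
    push_cast; ring
  simp_rw [h1]
  rw [rowMeasure, integral_fintype_prod_eq_prod (f := fun j (x : ℝ) => Complex.exp (z j * x * Complex.I))]
  simp_rw [← charFun_apply_real, charFun_gaussianReal]
  rw [← Complex.exp_sum]
  congr 1
  push_cast
  rw [Finset.sum_div, Finset.sum_div, ← Finset.sum_neg_distrib]
  refine Finset.sum_congr rfl fun j _ => ?_
  simp
  ring

/-- One-dimensional law. -/
lemma rowMeasure_map {d : ℕ} (z : Fin d → ℝ) (s : ℝ) (hs : (∑ j, z j ^ 2) / d = s ^ 2) :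
    (rowMeasure d).map (fun v => dotp v z) = (gaussianReal 0 1).map (fun g => s * g) := by
  have : IsProbabilityMeasure ((rowMeasure d).map (fun v => dotp v z)) :=
    Measure.isProbabilityMeasure_map (measurable_dotp z).aemeasurable
  rw [gaussianReal_map_const_mul]
  apply Measure.ext_of_charFun
  ext t
  rw [charFun_gaussianReal, charFun_apply_real, integral_map (measurable_dotp z).aemeasurable
    (by fun_prop)]
  have := rowMeasure_charFun (t • z)
  convert this using 2
  · ext v; congr 2; simp [dotp, Finset.mul_sum]
    refine Finset.sum_congr rfl fun j _ => ?_
    ring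
  · have h2 : (∑ j, (t • z) j ^ 2) / d = t ^ 2 * s ^ 2 := by
      rw [← hs]; simp [mul_pow, ← Finset.mul_sum, mul_div_assoc]
    rw [h2]; push_cast; simp; ring

/-- Joint law for orthogonal vectors. -/
lemma rowMeasure_map_pair {d : ℕ} (hd : 0 < d) (x w : Fin d → ℝ) (s : ℝ) (hx : ∑ j, x j ^ 2 = d)
    (hs : (∑ j, w j ^ 2) / d = s ^ 2) (hxw : ∑ j, x j * w j = 0) :
    (rowMeasure d).map (fun v => (dotp v x, dotp v w))
      = ((gaussianReal 0 1).prod (gaussianReal 0 1)).map (fun q => (q.1, s * q.2)) := by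
  have hm : Measurable (fun v : Fin d → ℝ => (dotp v x, dotp v w)) :=
    (measurable_dotp x).prodMk (measurable_dotp w)
  have : IsProbabilityMeasure ((rowMeasure d).map (fun v => (dotp v x, dotp v w))) :=
    Measure.isProbabilityMeasure_map hm.aemeasurable
  have e : ((gaussianReal 0 1).prod (gaussianReal 0 1)).map (fun q : ℝ × ℝ => (q.1, s * q.2))
      = (gaussianReal 0 1).prod ((gaussianReal 0 1).map (fun g => s * g)) := by
    have := Measure.map_prod_map (gaussianReal 0 1) (gaussianReal 0 1) (f := id)
      (g := fun g : ℝ => s * g) measurable_id (by fun_prop)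
    rw [Measure.map_id] at this
    rw [this]; rfl
  rw [e, gaussianReal_map_const_mul]
  apply Measure.ext_of_charFunDual
  ext L
  rw [charFunDual_prod, charFunDual_apply, integral_map hm.aemeasurable (by fun_prop),
    charFunDual_eq_charFun_map_one, charFunDual_eq_charFun_map_one]
  have hL : ∀ a b : ℝ, L (a, b) = a * L (1, 0) + b * L (0, 1) := by
    intro a b
    have : ((a, b) : ℝ × ℝ) = a • ((1, 0) : ℝ × ℝ) + b • ((0, 1) : ℝ × ℝ) := by simp
    rw [this, map_add, map_smul, map_smul]; simp
  set a := L (1, 0)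
  set b := L (0, 1)
  have h1 : (⇑(L.comp (ContinuousLinearMap.inl ℝ ℝ ℝ))) = fun g => a * g := by
    ext g; simp [hL g 0]; ring
  have h2 : (⇑(L.comp (ContinuousLinearMap.inr ℝ ℝ ℝ))) = fun g => b * g := by
    ext g; simp [hL 0 g]; ring
  rw [h1, h2, gaussianReal_map_const_mul, gaussianReal_map_const_mul, charFun_gaussianReal,
    charFun_gaussianReal, ← Complex.exp_add]
  have := rowMeasure_charFun (a • x + b • w)
  convert this using 2
  · ext v; congr 3; rw [hL]; simp [dotp, Finset.sum_mul, ← Finset.sum_add_distrib]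
    refine Finset.sum_congr rfl fun j _ => ?_
    ring
  · have h3 : ∑ j, (a • x + b • w) j ^ 2 = a ^ 2 * d + b ^ 2 * ∑ j, w j ^ 2 := by
      have : ∀ j, (a • x + b • w) j ^ 2 = a ^ 2 * x j ^ 2 + b ^ 2 * w j ^ 2 + 2 * a * b * (x j * w j) := by
        intro j; simp; ring
      simp_rw [this]
      rw [Finset.sum_add_distrib, Finset.sum_add_distrib, ← Finset.mul_sum, ← Finset.mul_sum,
        ← Finset.mul_sum, hx, hxw]; ring
    have h4 : (∑ j, (a • x + b • w) j ^ 2) / d = a ^ 2 + b ^ 2 * s ^ 2 := by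
      rw [h3, ← hs]; field_simp
    rw [h4]; push_cast; simp; ring

/-- Chernoff bound. -/
lemma chernoff {p d : ℕ} (f : (Fin d → ℝ) → ℝ)
    (hIntg : Integrable (fun v => Real.exp (f v)) (rowMeasure d)) (b t : ℝ)
    (hb : ∫ v, Real.exp (f v) ∂(rowMeasure d) ≤ Real.exp b) :
    gaussianMatrix p d {V | t * p ≤ ∑ k, f (V k)} ≤ ENNReal.ofReal (Real.exp (-(t - b) * p)) := by
  have hprod : ∀ V : Fin p → Fin d → ℝ, Real.exp (1 * ∑ k, f (V k)) = ∏ k, Real.exp (f (V k)) := by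
    intro V; rw [one_mul, Real.exp_sum]
  have hI : Integrable (fun V : Fin p → Fin d → ℝ => Real.exp (1 * ∑ k, f (V k)))
      (gaussianMatrix p d) := by
    simp_rw [hprod]
    exact Integrable.fintype_prod (f := fun _ v => Real.exp (f v)) (fun _ => hIntg)
  have h := measure_ge_le_exp_mul_mgf (μ := gaussianMatrix p d) (X := fun V => ∑ k, f (V k))
    (t := 1) (t * p) zero_le_one hI
  have hm : mgf (fun V : Fin p → Fin d → ℝ => ∑ k, f (V k)) (gaussianMatrix p d) 1
      ≤ Real.exp (b * p) := by
    rw [mgf]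
    simp_rw [hprod]
    rw [gaussianMatrix_eq, integral_fintype_prod_eq_prod (f := fun _ v => Real.exp (f v))]
    rw [Finset.prod_const, Finset.card_univ, Fintype.card_fin, mul_comm b, Real.exp_nat_mul]
    exact pow_le_pow_left₀ (integral_nonneg fun _ => (Real.exp_pos _).le) hb _
  rw [← ofReal_measureReal (by finiteness)]
  apply ENNReal.ofReal_le_ofReal
  refine h.trans ?_
  refine (mul_le_mul_of_nonneg_left hm (Real.exp_pos _).le).trans (le_of_eq ?_)
  rw [← Real.exp_add]; congr 1; ring

lemma integrable_gaussian_iff (f : ℝ → ℝ) (hf : Integrable (fun x => Real.exp (-(1/2) * x ^ 2) * f x)) :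
    Integrable f (gaussianReal 0 1) := by
  rw [gaussianReal_of_var_ne_zero _ (by norm_num),
    integrable_withDensity_iff_integrable_smul' (measurable_gaussianPDF _ _)
      (ae_of_all _ fun _ => gaussianPDF_lt_top)]
  simp only [toReal_gaussianPDF, gaussianPDFReal, smul_eq_mul]
  refine (hf.const_mul (Real.sqrt (2 * Real.pi * (1 : NNReal)))⁻¹).congr (ae_of_all _ fun x => ?_)
  simp only [sub_zero, NNReal.coe_one, mul_one]
  rw [mul_assoc]
  congr 3
  ring

lemma integrable_exp_sq {a : ℝ} (ha : a < 1 / 2) :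
    Integrable (fun g : ℝ => Real.exp (a * g ^ 2)) (gaussianReal 0 1) := by
  apply integrable_gaussian_iff
  have := integrable_exp_neg_mul_sq (b := 1 / 2 - a) (by linarith)
  convert this using 2 with x
  rw [← Real.exp_add]; congr 1; ring

lemma integral_sq_gaussian : ∫ g, g ^ 2 ∂(gaussianReal 0 1) = 1 := by
  have h := variance_fun_id_gaussianReal (μ := 0) (v := 1)
  rw [variance_of_integral_eq_zero (by fun_prop) (by simp)] at h
  simpa using h

lemma lip_growth {φ : ℝ → ℝ} {L : NNReal} (h : LipschitzWith L φ) (x : ℝ) :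
    |φ x| ≤ |φ 0| + L * |x| := by
  have := h.dist_le_mul x 0
  rw [Real.dist_eq, Real.dist_eq, sub_zero] at this
  have h2 := abs_sub_abs_le_abs_sub (φ x) (φ 0)
  linarith

lemma stein {φ : ℝ → ℝ} {L : NNReal} (hL : LipschitzWith L φ) (hd : Differentiable ℝ φ)
    (hc : Continuous (deriv φ)) :
    ∫ g, deriv φ g ∂(gaussianReal 0 1) = hermiteCoeff φ 1 := by
  have hb : ∀ x, |deriv φ x| ≤ L := fun x => by
    simpa using norm_deriv_le_of_lipschitz (x₀ := x) hL
  unfold hermiteCoeff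
  rw [integral_gaussianReal_eq_integral_smul (by norm_num),
    integral_gaussianReal_eq_integral_smul (by norm_num)]
  set C := (Real.sqrt (2 * Real.pi * (1 : NNReal)))⁻¹ with hC
  have hpdf : ∀ x, gaussianPDFReal 0 1 x = C * Real.exp (-(1/2) * x ^ 2) := by
    intro x; simp only [gaussianPDFReal, hC, sub_zero, NNReal.coe_one, mul_one]
    congr 2; ring
  have hH : ∀ x, hermiteFn 1 x = x := by
    intro x; simp [hermiteFn]
  simp_rw [hpdf, hH, smul_eq_mul]
  have i0 : Integrable (fun x : ℝ => Real.exp (-(1/2) * x ^ 2)) :=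
    integrable_exp_neg_mul_sq (by norm_num)
  have i1 : Integrable (fun x : ℝ => x * Real.exp (-(1/2) * x ^ 2)) :=
    integrable_mul_exp_neg_mul_sq (by norm_num)
  have i2 : Integrable (fun x : ℝ => x ^ 2 * Real.exp (-(1/2) * x ^ 2)) := by
    have := integrable_rpow_mul_exp_neg_mul_sq (b := 1/2) (by norm_num) (s := 2) (by norm_num)
    simpa using this
  have key := integral_mul_deriv_eq_deriv_mul_of_integrable (u := φ) (u' := deriv φ)
    (v := fun x => C * Real.exp (-(1/2) * x ^ 2))
    (v' := fun x => C * (Real.exp (-(1/2) * x ^ 2) * (-x)))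
    (fun x _ => (hd x).hasDerivAt)
    (fun x _ => by
      have h1 : HasDerivAt (fun x : ℝ => -(1/2) * x ^ 2) (-x) x := by
        exact ((hasDerivAt_pow 2 x).const_mul (-(1/2) : ℝ)).congr_deriv (by push_cast; ring)
      exact h1.exp.const_mul C)
    (by
      refine Integrable.mono' (g := fun x => |C| * (|φ 0| * ‖x * Real.exp (-(1/2) * x ^ 2)‖
        + L * (x ^ 2 * Real.exp (-(1/2) * x ^ 2)))) ?_ ?_ ?_
      · exact (((i1.norm).const_mul _).add (i2.const_mul _)).const_mul _
      · exact (by have := hL.continuous; fun_prop : Continuous _).aestronglyMeasurable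
      · refine ae_of_all _ fun x => ?_
        simp only [Pi.mul_apply, norm_mul, Real.norm_eq_abs, abs_neg, Real.abs_exp]
        have h1 := lip_growth hL x
        have h2 : 0 ≤ |C| * Real.exp (-(1/2) * x ^ 2) * |x| := by positivity
        have h3 := mul_le_mul_of_nonneg_right h1 h2
        have h4 : x ^ 2 = |x| * |x| := by rw [← sq, sq_abs]
        calc _ = |φ x| * (|C| * Real.exp (-(1/2) * x ^ 2) * |x|) := by ring
          _ ≤ _ := h3
          _ = |C| * (|φ 0| * (|x| * Real.exp (-(1/2) * x ^ 2)) + L * ((|x| * |x|) * Real.exp (-(1/2) * x ^ 2))) := by ring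
          _ = _ := by rw [← h4])
    (by
      refine Integrable.mono' (g := fun x => L * (|C| * Real.exp (-(1/2) * x ^ 2))) ?_ ?_ ?_
      · exact (i0.const_mul _).const_mul _
      · exact (by fun_prop : Continuous _).aestronglyMeasurable
      · refine ae_of_all _ fun x => ?_
        simp only [Pi.mul_apply, norm_mul, Real.norm_eq_abs, Real.abs_exp]
        exact mul_le_mul_of_nonneg_right (hb x) (by positivity))
    (by
      refine Integrable.mono' (g := fun x => |C| * (|φ 0| * Real.exp (-(1/2) * x ^ 2)
        + L * ‖x * Real.exp (-(1/2) * x ^ 2)‖)) ?_ ?_ ?_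
      · exact ((i0.const_mul _).add (i1.norm.const_mul _)).const_mul _
      · exact (by have := hL.continuous; fun_prop : Continuous _).aestronglyMeasurable
      · refine ae_of_all _ fun x => ?_
        simp only [Pi.mul_apply, norm_mul, Real.norm_eq_abs, Real.abs_exp]
        have h1 := lip_growth hL x
        have h2 : 0 ≤ |C| * Real.exp (-(1/2) * x ^ 2) := by positivity
        have h3 := mul_le_mul_of_nonneg_right h1 h2
        calc _ = |φ x| * (|C| * Real.exp (-(1/2) * x ^ 2)) := by ring
          _ ≤ _ := h3
          _ = _ := by ring)
  have e1 : ∫ x, C * Real.exp (-(1/2) * x ^ 2) * deriv φ x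
      = ∫ x, deriv φ x * (C * Real.exp (-(1/2) * x ^ 2)) := by
    congr 1; ext x; ring
  have e2 : ∫ x, C * Real.exp (-(1/2) * x ^ 2) * (φ x * x)
      = - ∫ x, φ x * (C * (Real.exp (-(1/2) * x ^ 2) * (-x))) := by
    rw [← integral_neg]; congr 1; ext x; ring
  rw [e1, e2, key, neg_neg]

/-- Truncated square. -/
def psi (m t : ℝ) : ℝ := (max (|t| - m) 0)

lemma psi_nonneg (m t : ℝ) : 0 ≤ psi m t := le_max_right _ _

lemma continuous_psi (m : ℝ) : Continuous (psi m) := by unfold psi; fun_prop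

lemma psi_le_abs {m : ℝ} (hm : 0 ≤ m) (t : ℝ) : psi m t ≤ |t| := by
  unfold psi; apply max_le <;> [linarith; positivity]

lemma psi_mono {m t u : ℝ} (h : |t| ≤ |u|) : psi m t ≤ psi m u := by
  unfold psi; exact max_le_max (by linarith) le_rfl

lemma trunc_mgf (b : ℝ) (hb : 0 < b) : ∃ m : ℝ, 0 < m ∧ ∀ s : ℝ, |s| ≤ 2 →
    Integrable (fun g => Real.exp (psi m (s * g) ^ 2 / 16)) (gaussianReal 0 1) ∧
    ∫ g, Real.exp (psi m (s * g) ^ 2 / 16) ∂(gaussianReal 0 1) ≤ Real.exp b := by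
  have hdom : ∀ m : ℝ, 0 ≤ m → ∀ s : ℝ, |s| ≤ 2 → ∀ g : ℝ,
      Real.exp (psi m (s * g) ^ 2 / 16) ≤ Real.exp ((1/4) * g ^ 2) := by
    intro m hm s hs g
    apply Real.exp_le_exp.2
    have h1 : psi m (s * g) ≤ 2 * |g| := by
      refine (psi_le_abs hm _).trans ?_
      rw [abs_mul]; exact mul_le_mul_of_nonneg_right hs (abs_nonneg _)
    have h2 := pow_le_pow_left₀ (psi_nonneg m (s * g)) h1 2
    rw [mul_pow, sq_abs] at h2
    linarith
  have hIntg : ∀ m : ℝ, 0 ≤ m → ∀ s : ℝ, |s| ≤ 2 →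
      Integrable (fun g => Real.exp (psi m (s * g) ^ 2 / 16)) (gaussianReal 0 1) := by
    intro m hm s hs
    refine (integrable_exp_sq (a := 1/4) (by norm_num)).mono' ?_ (ae_of_all _ fun g => ?_)
    · exact (by have := continuous_psi m; fun_prop : Continuous _).aestronglyMeasurable
    · rw [Real.norm_eq_abs, Real.abs_exp]; exact hdom m hm s hs g
  have hlim : Tendsto (fun n : ℕ => ∫ g, Real.exp (psi n (2 * g) ^ 2 / 16) ∂(gaussianReal 0 1))
      atTop (nhds (∫ g, (1 : ℝ) ∂(gaussianReal 0 1))) := by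
    refine tendsto_integral_of_dominated_convergence (fun g => Real.exp ((1/4) * g ^ 2)) ?_
      (integrable_exp_sq (by norm_num)) ?_ ?_
    · intro n
      exact (by have := continuous_psi n; fun_prop : Continuous _).aestronglyMeasurable
    · intro n
      refine ae_of_all _ fun g => ?_
      rw [Real.norm_eq_abs, Real.abs_exp]
      exact hdom n (by positivity) 2 (by simp) g
    · refine ae_of_all _ fun g => ?_
      obtain ⟨N, hN⟩ := exists_nat_gt |2 * g|
      refine tendsto_const_nhds.congr' ?_
      filter_upwards [eventually_ge_atTop N] with n hn
      have : (N : ℝ) ≤ n := by exact_mod_cast hn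
      have h0 : psi n (2 * g) = 0 := by
        unfold psi; exact max_eq_right (by linarith)
      simp [h0]
  have hlt : ∫ g, (1 : ℝ) ∂(gaussianReal 0 1) < Real.exp b := by
    simp [hb]
  obtain ⟨n, hn, hn1⟩ := ((hlim.eventually (gt_mem_nhds hlt)).and (eventually_ge_atTop 1)).exists
  have hn0 : (0 : ℝ) < n := by exact_mod_cast hn1
  refine ⟨n, hn0, fun s hs => ⟨hIntg n hn0.le s hs, le_trans ?_ hn.le⟩⟩
  refine integral_mono (hIntg n hn0.le s hs) (hIntg n hn0.le 2 (by simp)) fun g => ?_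
  apply Real.exp_le_exp.2
  have : psi n (s * g) ≤ psi n (2 * g) := psi_mono (by
    rw [abs_mul, abs_mul]; exact mul_le_mul_of_nonneg_right (by simpa using hs) (abs_nonneg _))
  have := pow_le_pow_left₀ (psi_nonneg _ _) this 2
  linarith

lemma exp_quad (x : ℝ) : Real.exp x ≤ 1 + x + x ^ 2 * Real.exp |x| := by
  have h := Complex.norm_exp_sub_sum_le_norm_mul_exp (x : ℂ) 2
  have e : Complex.exp x - ∑ m ∈ Finset.range 2, (x : ℂ) ^ m / (m.factorial : ℂ)
      = ((Real.exp x - (1 + x) : ℝ) : ℂ) := by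
    simp [Finset.sum_range_succ]
  rw [e, Complex.norm_real, Complex.norm_real, Real.norm_eq_abs, Real.norm_eq_abs, sq_abs] at h
  have := le_abs_self (Real.exp x - (1 + x))
  linarith

lemma main_mgf (ψ : ℝ → ℝ) (hc : Continuous ψ) (L : ℝ) (hL : ∀ x, |ψ x| ≤ L) (μ : ℝ)
    (hμ : ∫ g, ψ g ∂(gaussianReal 0 1) = μ) :
    ∃ θ₀ : ℝ, 0 < θ₀ ∧ ∃ K : ℝ, 0 ≤ K ∧ ∀ θ : ℝ, |θ| ≤ θ₀ →
      Integrable (fun q : ℝ × ℝ => Real.exp (θ * (ψ q.1 * q.2 ^ 2 - μ)))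
        ((gaussianReal 0 1).prod (gaussianReal 0 1)) ∧
      ∫ q : ℝ × ℝ, Real.exp (θ * (ψ q.1 * q.2 ^ 2 - μ))
        ∂((gaussianReal 0 1).prod (gaussianReal 0 1)) ≤ Real.exp (θ ^ 2 * K) := by
  have hL0 : 0 ≤ L := (abs_nonneg _).trans (hL 0)
  set P := (gaussianReal 0 1).prod (gaussianReal 0 1)
  set B := L + |μ| + 1 with hB
  have hB1 : 1 ≤ B := by have := abs_nonneg μ; linarith
  set X : ℝ × ℝ → ℝ := fun q => ψ q.1 * q.2 ^ 2 - μ with hX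
  have hXc : Continuous X := by fun_prop
  have hXb : ∀ q, |X q| ≤ B * (1 + q.2 ^ 2) := by
    intro q
    have h1 : |X q| ≤ |ψ q.1 * q.2 ^ 2| + |μ| := abs_sub _ _
    rw [abs_mul, abs_of_nonneg (sq_nonneg q.2)] at h1
    have h2 := mul_le_mul_of_nonneg_right (hL q.1) (sq_nonneg q.2)
    have h3 : 0 ≤ (|μ| + 1) * q.2 ^ 2 := by positivity
    nlinarith
  have hE : Integrable (fun q : ℝ × ℝ => Real.exp ((1 + q.2 ^ 2) / 8)) P := by
    have h1 := (integrable_exp_sq (a := 1/8) (by norm_num)).const_mul (Real.exp (1/8))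
    have h2 := h1.comp_snd (gaussianReal 0 1)
    refine h2.congr (ae_of_all _ fun q => ?_)
    simp only
    rw [← Real.exp_add]; congr 1; ring
  set θ₀ := 1 / (16 * B) with hθ₀
  have hθpos : 0 < θ₀ := by positivity
  have hθX : ∀ q, θ₀ * |X q| ≤ (1 + q.2 ^ 2) / 16 := by
    intro q
    have := mul_le_mul_of_nonneg_left (hXb q) hθpos.le
    refine this.trans (le_of_eq ?_)
    rw [hθ₀]; field_simp
  have hR : Integrable (fun q => X q ^ 2 * Real.exp (θ₀ * |X q|)) P := by
    refine (hE.const_mul (2 / θ₀ ^ 2)).mono' (by fun_prop) (ae_of_all _ fun q => ?_)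
    rw [Real.norm_eq_abs, abs_of_nonneg (by positivity)]
    have h1 := Real.quadratic_le_exp_of_nonneg (x := θ₀ * |X q|) (by positivity)
    have h2 : (θ₀ * |X q|) ^ 2 ≤ 2 * Real.exp (θ₀ * |X q|) := by
      have : 0 ≤ θ₀ * |X q| := by positivity
      nlinarith
    have h3 : X q ^ 2 ≤ 2 / θ₀ ^ 2 * Real.exp (θ₀ * |X q|) := by
      rw [mul_pow, sq_abs] at h2
      rw [div_mul_eq_mul_div, le_div_iff₀ (by positivity)]; linarith
    calc X q ^ 2 * Real.exp (θ₀ * |X q|)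
        ≤ 2 / θ₀ ^ 2 * Real.exp (θ₀ * |X q|) * Real.exp (θ₀ * |X q|) := by gcongr
      _ = 2 / θ₀ ^ 2 * Real.exp (θ₀ * |X q| + θ₀ * |X q|) := by rw [Real.exp_add]; ring
      _ ≤ 2 / θ₀ ^ 2 * Real.exp ((1 + q.2 ^ 2) / 8) := by
        have := hθX q
        gcongr; linarith
  have hXi : Integrable X P := by
    refine (hE.const_mul (1 / θ₀)).mono' (by fun_prop) (ae_of_all _ fun q => ?_)
    rw [Real.norm_eq_abs]
    have h1 := Real.add_one_le_exp (θ₀ * |X q|)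
    have h2 : Real.exp (θ₀ * |X q|) ≤ Real.exp ((1 + q.2 ^ 2) / 8) := by
      apply Real.exp_le_exp.2
      have := hθX q
      have := sq_nonneg q.2
      linarith
    rw [div_mul_eq_mul_div, le_div_iff₀ hθpos]; linarith
  have hX0 : ∫ q, X q ∂P = 0 := by
    have i1 : Integrable (fun q : ℝ × ℝ => ψ q.1 * q.2 ^ 2) P := by
      have := hXi.add (integrable_const μ)
      refine this.congr (ae_of_all _ fun q => ?_)
      simp [hX]
    rw [hX, integral_sub i1 (integrable_const _), integral_prod_mul (f := ψ) (g := fun y : ℝ => y ^ 2),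
      hμ, integral_sq_gaussian]
    simp
  refine ⟨θ₀, hθpos, ∫ q, X q ^ 2 * Real.exp (θ₀ * |X q|) ∂P,
    integral_nonneg fun q => by positivity, fun θ hθ => ?_⟩
  have hI : Integrable (fun q => Real.exp (θ * X q)) P := by
    refine hE.mono' (by fun_prop) (ae_of_all _ fun q => ?_)
    rw [Real.norm_eq_abs, Real.abs_exp]
    apply Real.exp_le_exp.2
    have h1 := hθX q
    have h2 : θ * X q ≤ θ₀ * |X q| := (le_abs_self _).trans (by rw [abs_mul]; gcongr)
    have := sq_nonneg q.2
    linarith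
  refine ⟨hI, ?_⟩
  calc ∫ q, Real.exp (θ * X q) ∂P
      ≤ ∫ q, (1 + θ * X q) + θ ^ 2 * (X q ^ 2 * Real.exp (θ₀ * |X q|)) ∂P := by
        refine integral_mono hI (((integrable_const _).add (hXi.const_mul _)).add
          (hR.const_mul _)) fun q => ?_
        have h1 := exp_quad (θ * X q)
        have h2 : Real.exp |θ * X q| ≤ Real.exp (θ₀ * |X q|) := by
          apply Real.exp_le_exp.2; rw [abs_mul]; gcongr
        have h3 : (θ * X q) ^ 2 * Real.exp |θ * X q| ≤ (θ * X q) ^ 2 * Real.exp (θ₀ * |X q|) := by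
          gcongr
        simp only
        nlinarith
    _ = 1 + θ ^ 2 * ∫ q, X q ^ 2 * Real.exp (θ₀ * |X q|) ∂P := by
        have i3 : Integrable (fun q => 1 + θ * X q) P := (integrable_const _).add (hXi.const_mul _)
        rw [integral_add i3 (hR.const_mul _), integral_add (integrable_const _) (hXi.const_mul _), integral_const_mul,
          integral_const_mul, hX0]
        simp
    _ ≤ _ := by
        have := Real.add_one_le_exp (θ ^ 2 * ∫ q, X q ^ 2 * Real.exp (θ₀ * |X q|) ∂P)
        linarith

/-- Squared Euclidean norm. -/
def nsq {d : ℕ} (x : Fin d → ℝ) : ℝ := ∑ j, x j ^ 2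

lemma nsq_nonneg {d : ℕ} (x : Fin d → ℝ) : 0 ≤ nsq x := Finset.sum_nonneg fun _ _ => sq_nonneg _

lemma dotp_add {d : ℕ} (v x y : Fin d → ℝ) : dotp v (x + y) = dotp v x + dotp v y := by
  simp [dotp, mul_add, Finset.sum_add_distrib]

lemma dotp_sub {d : ℕ} (v x y : Fin d → ℝ) : dotp v (x - y) = dotp v x - dotp v y := by
  simp [dotp, mul_sub, Finset.sum_sub_distrib]

lemma dotp_smul {d : ℕ} (v x : Fin d → ℝ) (a : ℝ) : dotp v (a • x) = a * dotp v x := by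
  simp only [dotp, Finset.mul_sum, Pi.smul_apply, smul_eq_mul]
  exact Finset.sum_congr rfl fun j _ => by ring

lemma dotp_comm' {d : ℕ} (v x : Fin d → ℝ) : dotp v x = dotp x v := by
  simp only [dotp, mul_comm]

lemma nsq_eq {d : ℕ} (x : Fin d → ℝ) : nsq x = dotp x x := by
  simp only [nsq, dotp, sq]

lemma nsq_add {d : ℕ} (x y : Fin d → ℝ) : nsq (x + y) = nsq x + 2 * dotp x y + nsq y := by
  rw [nsq_eq, dotp_add, dotp_comm' (x + y), dotp_comm' (x + y), dotp_add, dotp_add,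
    dotp_comm' y x, nsq_eq, nsq_eq]; ring

lemma nsq_sub {d : ℕ} (x y : Fin d → ℝ) : nsq (x - y) = nsq x - 2 * dotp x y + nsq y := by
  rw [nsq_eq, dotp_sub, dotp_comm' (x - y), dotp_comm' (x - y), dotp_sub, dotp_sub,
    dotp_comm' y x, nsq_eq, nsq_eq]; ring

lemma nsq_smul {d : ℕ} (x : Fin d → ℝ) (a : ℝ) : nsq (a • x) = a ^ 2 * nsq x := by
  rw [nsq_eq, dotp_smul, dotp_comm', dotp_smul, nsq_eq]; ring

lemma dotp_sq_le {d : ℕ} (x y : Fin d → ℝ) : dotp x y ^ 2 ≤ nsq x * nsq y :=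
  Finset.sum_mul_sq_le_sq_mul_sq _ _ _

/-- Projection orthogonal to `x`. -/
def proj {d : ℕ} (x z : Fin d → ℝ) : Fin d → ℝ := z - (dotp x z / d) • x

lemma proj_sub {d : ℕ} (x y z : Fin d → ℝ) : proj x (y - z) = proj x y - proj x z := by
  simp only [proj, dotp_sub, sub_div, sub_smul]; abel

lemma nsq_proj {d : ℕ} (hd : 0 < d) (x z : Fin d → ℝ) (hx : nsq x = d) :
    nsq (proj x z) = nsq z - dotp x z ^ 2 / d := by
  have : (d : ℝ) ≠ 0 := by positivity
  rw [proj, nsq_sub, dotp_smul, nsq_smul, hx, dotp_comm' z x]; field_simp; ring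

lemma nsq_proj_le {d : ℕ} (hd : 0 < d) (x z : Fin d → ℝ) (hx : nsq x = d) :
    nsq (proj x z) ≤ nsq z := by
  rw [nsq_proj hd x z hx]
  have : 0 ≤ dotp x z ^ 2 / d := by positivity
  linarith

lemma dotp_proj {d : ℕ} (hd : 0 < d) (x z : Fin d → ℝ) (hx : nsq x = d) :
    dotp x (proj x z) = 0 := by
  have : (d : ℝ) ≠ 0 := by positivity
  rw [proj, dotp_sub, dotp_smul, ← nsq_eq, hx]; field_simp; ring

/-- Grid net. -/
def net (d : ℕ) : Finset (Fin d → ℝ) :=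
  (Fintype.piFinset (fun _ : Fin d => Finset.Icc (-((d : ℤ) ^ 2)) ((d : ℤ) ^ 2))).image
    (fun (j : Fin d → ℤ) i => (j i : ℝ) / d)

lemma net_card (d : ℕ) : (net d).card ≤ (2 * d ^ 2 + 1) ^ d := by
  refine Finset.card_image_le.trans ?_
  rw [Fintype.card_piFinset]
  simp only [Int.card_Icc, Finset.prod_const, Finset.card_univ, Fintype.card_fin]
  refine Nat.pow_le_pow_left ?_ _
  zify
  rw [Int.toNat_of_nonneg (by have := sq_nonneg (d : ℤ); linarith)]
  linarith

lemma net_exists {d : ℕ} (hd : 0 < d) (y : Fin d → ℝ) (hy : nsq y ≤ d) :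
    ∃ z ∈ net d, nsq z ≤ 4 * d ∧ nsq (y - z) ≤ 1 / d := by
  have hd1 : (1 : ℝ) ≤ d := by exact_mod_cast hd
  have hd0 : (0 : ℝ) < d := by positivity
  have hr : ∀ j, |y j - (⌊d * y j⌋ : ℝ) / d| ≤ 1 / d := by
    intro j
    have h1 := Int.floor_le (d * y j)
    have h2 := Int.lt_floor_add_one (d * y j)
    have e : y j - (⌊d * y j⌋ : ℝ) / d = (d * y j - ⌊d * y j⌋) / d := by field_simp
    rw [e, abs_div, abs_of_pos hd0, abs_of_nonneg (by linarith)]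
    gcongr; linarith
  have hn : nsq (y - fun i => (⌊d * y i⌋ : ℝ) / d) ≤ 1 / d := by
    calc nsq (y - fun i => (⌊d * y i⌋ : ℝ) / d) ≤ ∑ _j : Fin d, (1 / d : ℝ) ^ 2 := by
          refine Finset.sum_le_sum fun j _ => ?_
          rw [← sq_abs]
          exact pow_le_pow_left₀ (abs_nonneg _) (hr j) 2
      _ = 1 / d := by simp; field_simp
  refine ⟨fun i => (⌊d * y i⌋ : ℝ) / d, ?_, ?_, hn⟩
  · refine Finset.mem_image.2 ⟨fun i => ⌊d * y i⌋, ?_, rfl⟩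
    refine Fintype.mem_piFinset.2 fun j => ?_
    have hj : y j ^ 2 ≤ (d : ℝ) ^ 2 := by
      have : y j ^ 2 ≤ nsq y :=
        Finset.single_le_sum (f := fun j => y j ^ 2) (fun _ _ => sq_nonneg _) (Finset.mem_univ j)
      nlinarith
    have hj' := abs_le.1 (abs_le_of_sq_le_sq hj hd0.le)
    rw [Finset.mem_Icc]
    constructor
    · apply Int.le_floor.2; push_cast; nlinarith [hj'.1]
    · have : (⌊d * y j⌋ : ℝ) ≤ ((d : ℤ) ^ 2 : ℤ) := by
        refine (Int.floor_le _).trans ?_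
        push_cast; nlinarith [hj'.2]
      exact_mod_cast this
  · set z : Fin d → ℝ := fun i => (⌊d * y i⌋ : ℝ) / d
    have h1 : nsq z ≤ 2 * nsq y + 2 * nsq (y - z) := by
      simp only [nsq, Finset.mul_sum, ← Finset.sum_add_distrib]
      refine Finset.sum_le_sum fun j _ => ?_
      simp only [Pi.sub_apply]
      nlinarith [sq_nonneg (2 * y j - z j)]
    have : 1 / (d : ℝ) ≤ 1 := by rw [div_le_one hd0]; exact hd1
    linarith

/-- The good event. -/
structure Good {p d : ℕ} (ψ : ℝ → ℝ) (μ m τ : ℝ) (x : Fin d → ℝ) (V : Fin p → Fin d → ℝ) : Prop where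
  g1 : ∀ z ∈ net d, nsq z ≤ 4 * d → ∑ k, psi m (dotp (V k) z) ^ 2 ≤ τ * p
  g2 : ∀ j : Fin d, ∑ k, psi m (dotp (V k) (Pi.single j (Real.sqrt d))) ^ 2 ≤ τ * p
  g3 : ∀ z ∈ net d, nsq z ≤ 4 * d →
    |∑ k, ψ (dotp (V k) x) * dotp (V k) (proj x z) ^ 2 - p * (μ * (nsq (proj x z) / d))| ≤ τ * p

lemma sq_le_psi {m : ℝ} (hm : 0 ≤ m) (t : ℝ) : t ^ 2 ≤ 2 * psi m t ^ 2 + 2 * m ^ 2 := by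
  have h1 : |t| ≤ psi m t + m := by unfold psi; linarith [le_max_left (|t| - m) 0]
  have h2 := pow_le_pow_left₀ (abs_nonneg t) h1 2
  rw [sq_abs] at h2
  nlinarith [sq_nonneg (psi m t - m)]

lemma psi_add {m : ℝ} (s t : ℝ) : psi m (s + t) ^ 2 ≤ 2 * psi m s ^ 2 + 2 * t ^ 2 := by
  have h1 : psi m (s + t) ≤ psi m s + |t| := by
    unfold psi
    apply max_le
    · linarith [le_max_left (|s| - m) 0, abs_add_le s t]
    · linarith [le_max_right (|s| - m) 0, abs_nonneg t]
  have h2 := pow_le_pow_left₀ (psi_nonneg _ _) h1 2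
  rw [← sq_abs t]
  nlinarith [sq_nonneg (psi m s - |t|)]

lemma scalarC {ε : ℝ} (hε : 0 < ε) (s t : ℝ) :
    |s ^ 2 - t ^ 2| ≤ ε * s ^ 2 + (1 / ε + 1) * (s - t) ^ 2 := by
  have h1 : |2 * s * (s - t)| ≤ ε * s ^ 2 + 1 / ε * (s - t) ^ 2 := by
    have e3 : ε * s ^ 2 + 1 / ε * (s - t) ^ 2 - 2 * s * (s - t)
        = 1 / ε * (ε * s - (s - t)) ^ 2 := by field_simp; ring
    have e4 : ε * s ^ 2 + 1 / ε * (s - t) ^ 2 + 2 * s * (s - t)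
        = 1 / ε * (ε * s + (s - t)) ^ 2 := by field_simp; ring
    have p3 : 0 ≤ 1 / ε * (ε * s - (s - t)) ^ 2 := by positivity
    have p4 : 0 ≤ 1 / ε * (ε * s + (s - t)) ^ 2 := by positivity
    rw [abs_le]; constructor <;> linarith
  have e2 : s ^ 2 - t ^ 2 = 2 * s * (s - t) - (s - t) ^ 2 := by ring
  rw [e2]
  have h2 := abs_sub (2 * s * (s - t)) ((s - t) ^ 2)
  rw [abs_of_nonneg (sq_nonneg (s - t))] at h2
  linarith

section det
variable {p d : ℕ} {ψ : ℝ → ℝ} {μ m τ : ℝ} {x : Fin d → ℝ} {V : Fin p → Fin d → ℝ}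

lemma good_frob (hd : 0 < d) (hm : 0 ≤ m) (hG : Good ψ μ m τ x V) (r : Fin d → ℝ) :
    ∑ k, dotp (V k) r ^ 2 ≤ (2 * τ + 2 * m ^ 2) * p * nsq r := by
  have hd0 : (0 : ℝ) < d := by positivity
  have hcol : ∀ j, ∑ k, V k j ^ 2 ≤ (2 * τ + 2 * m ^ 2) * p / d := by
    intro j
    rw [le_div_iff₀ hd0]
    calc (∑ k, V k j ^ 2) * d = ∑ k, dotp (V k) (Pi.single j (Real.sqrt d)) ^ 2 := by
          rw [Finset.sum_mul]
          refine Finset.sum_congr rfl fun k _ => ?_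
          have : dotp (V k) (Pi.single j (Real.sqrt d)) = V k j * Real.sqrt d := by
            simp [dotp, Pi.single_apply]
          rw [this, mul_pow, Real.sq_sqrt hd0.le]
      _ ≤ ∑ k, (2 * psi m (dotp (V k) (Pi.single j (Real.sqrt d))) ^ 2 + 2 * m ^ 2) :=
          Finset.sum_le_sum fun k _ => sq_le_psi hm _
      _ = 2 * ∑ k, psi m (dotp (V k) (Pi.single j (Real.sqrt d))) ^ 2 + 2 * m ^ 2 * p := by
          rw [Finset.sum_add_distrib, ← Finset.mul_sum]; simp; ring
      _ ≤ _ := by have := hG.g2 j; linarith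
  calc ∑ k, dotp (V k) r ^ 2 ≤ ∑ k, nsq (V k) * nsq r := Finset.sum_le_sum fun k _ => dotp_sq_le _ _
    _ = (∑ j, ∑ k, V k j ^ 2) * nsq r := by
        rw [← Finset.sum_mul, Finset.sum_comm]; rfl
    _ ≤ (∑ _j : Fin d, (2 * τ + 2 * m ^ 2) * p / d) * nsq r := by
        gcongr with j
        · exact nsq_nonneg r
        · exact hcol j
    _ = _ := by
        rw [Finset.sum_const, Finset.card_univ, Fintype.card_fin, nsmul_eq_mul]
        field_simp

lemma good_psi (hd : 0 < d) (hm : 0 ≤ m) (hτ : 0 ≤ τ) (hG : Good ψ μ m τ x V)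
    (hdl : 2 * (6 * τ + 2 * m ^ 2) ≤ τ * d) (y : Fin d → ℝ) (hy : nsq y ≤ d) :
    ∑ k, psi m (dotp (V k) y) ^ 2 ≤ 3 * τ * p := by
  have hd0 : (0 : ℝ) < d := by positivity
  obtain ⟨z, hz, hz4, hr⟩ := net_exists hd y hy
  have h1 := good_frob hd hm hG (y - z)
  have h2 := hG.g1 z hz hz4
  have h3 : ∑ k, psi m (dotp (V k) y) ^ 2 ≤
      2 * ∑ k, psi m (dotp (V k) z) ^ 2 + 2 * ∑ k, dotp (V k) (y - z) ^ 2 := by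
    rw [Finset.mul_sum, Finset.mul_sum, ← Finset.sum_add_distrib]
    refine Finset.sum_le_sum fun k _ => ?_
    have := psi_add (m := m) (dotp (V k) z) (dotp (V k) (y - z))
    rwa [← dotp_add, add_sub_cancel] at this
  have h4 : (2 * τ + 2 * m ^ 2) * p * nsq (y - z) ≤ (2 * τ + 2 * m ^ 2) * p * (1 / d) := by
    gcongr
  have h5 : 2 * ((2 * τ + 2 * m ^ 2) * p * (1 / d)) ≤ τ * p := by
    have : 2 * (2 * τ + 2 * m ^ 2) * (1 / d) ≤ τ := by
      rw [mul_one_div, div_le_iff₀ hd0]; linarith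
    have := mul_le_mul_of_nonneg_right this (Nat.cast_nonneg (α := ℝ) p)
    linarith
  linarith

lemma good_sq (hd : 0 < d) (hm : 0 ≤ m) (hτ : 0 ≤ τ) (hG : Good ψ μ m τ x V)
    (hdl : 2 * (6 * τ + 2 * m ^ 2) ≤ τ * d) (y : Fin d → ℝ) (hy : nsq y ≤ d) :
    ∑ k, dotp (V k) y ^ 2 ≤ (6 * τ + 2 * m ^ 2) * p := by
  have h1 := good_psi hd hm hτ hG hdl y hy
  have h2 : ∑ k, dotp (V k) y ^ 2 ≤ ∑ k, (2 * psi m (dotp (V k) y) ^ 2 + 2 * m ^ 2) :=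
    Finset.sum_le_sum fun k _ => sq_le_psi hm _
  rw [Finset.sum_add_distrib, ← Finset.mul_sum] at h2
  simp at h2
  linarith

set_option maxHeartbeats 1600000 in
/-- Deterministic conclusion on the good event. -/
lemma good_main (hd : 0 < d) (hm : 0 ≤ m) (hτ : 0 ≤ τ) (hG : Good ψ μ m τ x V)
    (hdl : 2 * (6 * τ + 2 * m ^ 2) ≤ τ * d) (hx : nsq x = d) {L L' : ℝ}
    (hL : ∀ t, |ψ t| ≤ L) (hL' : ∀ s t, |ψ s - ψ t| ≤ L' * |s - t|) (hL'0 : 0 ≤ L')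
    {ε : ℝ} (hε : 0 < ε) (hε1 : ε ≤ 1) (y e : Fin d → ℝ) (hy : nsq y = d)
    (hxy : dotp x y ^ 2 ≤ ε ^ 2 * d ^ 2) (he : nsq e ≤ ε ^ 2 * d)
    {C η : ℝ} (hC : C = 6 * τ + 2 * m ^ 2)
    (hη1 : (12 * L + 1) * τ ≤ η / 4)
    (hη2 : ε * (m ^ 2 * L' * (1 + C) + 4 * L * C + |μ|) ≤ η / 4)
    (hη3 : (L * (1 / ε + 1) * C + 3 * |μ|) / d ≤ η / 4) (hη : 0 < η) :
    |∑ k, ψ (dotp (V k) (x + e)) * dotp (V k) y ^ 2 - p * μ| ≤ η * p := by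
  have hd0 : (0 : ℝ) < d := by positivity
  have hd1 : (1 : ℝ) ≤ d := by exact_mod_cast hd
  have hL0 : 0 ≤ L := (abs_nonneg _).trans (hL 0)
  have hp0 : (0 : ℝ) ≤ p := Nat.cast_nonneg p
  have hC0 : 0 ≤ C := by rw [hC]; positivity
  have hsq := good_sq hd hm hτ hG hdl
  rw [← hC] at hsq
  have hpsi := good_psi hd hm hτ hG hdl
  obtain ⟨z, hz, hz4, hr⟩ := net_exists hd y hy.le
  set a := dotp x y / d with ha
  set w := proj x y with hw
  set w0 := proj x z with hw0
  have hwr : proj x (y - z) = w - w0 := proj_sub x y z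
  have ha2 : a ^ 2 ≤ ε ^ 2 := by
    rw [ha, div_pow, div_le_iff₀ (by positivity)]; exact hxy
  have haa : |a| ≤ ε := abs_le_of_sq_le_sq ha2 hε.le
  have hrn : nsq (w - w0) ≤ 1 / d := by
    rw [← hwr]; exact (nsq_proj_le hd x _ hx).trans hr
  have hwn : nsq w ≤ d := by rw [hw, ← hy]; exact nsq_proj_le hd x _ hx
  have hwn' : nsq w = d - a ^ 2 * d := by
    rw [hw, nsq_proj hd x y hx, hy, ha]; field_simp
  -- step A
  have hA : |∑ k, (ψ (dotp (V k) (x + e)) - ψ (dotp (V k) x)) * dotp (V k) y ^ 2|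
      ≤ (12 * L * τ + ε * (m ^ 2 * L' * (1 + C))) * p := by
    set q : Fin d → ℝ := ε⁻¹ • e with hq
    have hqe : e = ε • q := by rw [hq, smul_smul, mul_inv_cancel₀ hε.ne', one_smul]
    have hqn : nsq q ≤ d := by
      rw [hq, nsq_smul, inv_pow, inv_mul_le_iff₀ (by positivity)]; exact he
    calc _ ≤ ∑ k, |(ψ (dotp (V k) (x + e)) - ψ (dotp (V k) x)) * dotp (V k) y ^ 2| :=
          Finset.abs_sum_le_sum_abs _ _
      _ ≤ ∑ k, (4 * L * psi m (dotp (V k) y) ^ 2 + m ^ 2 * L' * ε * (1 + dotp (V k) q ^ 2)) := by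
          refine Finset.sum_le_sum fun k _ => ?_
          rw [abs_mul, abs_of_nonneg (sq_nonneg (dotp (V k) y))]
          set Δ := |ψ (dotp (V k) (x + e)) - ψ (dotp (V k) x)| with hΔ
          have hΔ0 : 0 ≤ Δ := abs_nonneg _
          have h1 : Δ ≤ 2 * L := by
            have := abs_sub (ψ (dotp (V k) (x + e))) (ψ (dotp (V k) x))
            have := hL (dotp (V k) (x + e))
            have := hL (dotp (V k) x)
            linarith
          have h2 : Δ ≤ L' * ε * ((1 + dotp (V k) q ^ 2) / 2) := by
            have h3 := hL' (dotp (V k) (x + e)) (dotp (V k) x)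
            rw [dotp_add, add_sub_cancel_left, hqe, dotp_smul, abs_mul, abs_of_pos hε] at h3
            have h4 : |dotp (V k) q| ≤ (1 + dotp (V k) q ^ 2) / 2 := by
              rw [← sq_abs]; nlinarith [sq_nonneg (|dotp (V k) q| - 1)]
            have h5 : L' * ε * |dotp (V k) q| ≤ L' * ε * ((1 + dotp (V k) q ^ 2) / 2) := by
              gcongr
            rw [hΔ, dotp_add, hqe, dotp_smul]
            linarith
          have h3 := sq_le_psi hm (dotp (V k) y)
          calc Δ * dotp (V k) y ^ 2 ≤ Δ * (2 * psi m (dotp (V k) y) ^ 2 + 2 * m ^ 2) := by gcongr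
            _ = Δ * (2 * psi m (dotp (V k) y) ^ 2) + Δ * (2 * m ^ 2) := by ring
            _ ≤ (2 * L) * (2 * psi m (dotp (V k) y) ^ 2)
                + (L' * ε * ((1 + dotp (V k) q ^ 2) / 2)) * (2 * m ^ 2) := by gcongr
            _ = _ := by ring
      _ = 4 * L * ∑ k, psi m (dotp (V k) y) ^ 2
            + m ^ 2 * L' * ε * (p + ∑ k, dotp (V k) q ^ 2) := by
          rw [Finset.sum_add_distrib, ← Finset.mul_sum, ← Finset.mul_sum, Finset.sum_add_distrib]
          simp
      _ ≤ 4 * L * (3 * τ * p) + m ^ 2 * L' * ε * (p + C * p) := by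
          have h1 := hpsi y hy.le
          have h2 := hsq q hqn
          gcongr
      _ = _ := by ring
  -- step B
  have hB : |∑ k, ψ (dotp (V k) x) * (dotp (V k) y ^ 2 - dotp (V k) w ^ 2)|
      ≤ 3 * L * ε * C * p := by
    calc _ ≤ ∑ k, |ψ (dotp (V k) x) * (dotp (V k) y ^ 2 - dotp (V k) w ^ 2)| :=
          Finset.abs_sum_le_sum_abs _ _
      _ ≤ ∑ k, L * (ε * (2 * dotp (V k) x ^ 2 + dotp (V k) w ^ 2)) := by
          refine Finset.sum_le_sum fun k _ => ?_
          rw [abs_mul]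
          refine mul_le_mul (hL _) ?_ (abs_nonneg _) hL0
          have e1 : dotp (V k) y = dotp (V k) w + a * dotp (V k) x := by
            rw [hw, proj, dotp_sub, dotp_smul]; ring
          rw [e1]
          set s := dotp (V k) w
          set t := dotp (V k) x
          have e2 : (s + a * t) ^ 2 - s ^ 2 = a * (2 * s * t) + a ^ 2 * t ^ 2 := by ring
          rw [e2]
          have h1 : |2 * s * t| ≤ s ^ 2 + t ^ 2 := by
            rw [abs_le]; constructor <;> nlinarith [sq_nonneg (s + t), sq_nonneg (s - t)]
          have h2 : a ^ 2 ≤ ε := by nlinarith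
          calc |a * (2 * s * t) + a ^ 2 * t ^ 2| ≤ |a * (2 * s * t)| + |a ^ 2 * t ^ 2| :=
                abs_add_le _ _
            _ = |a| * |2 * s * t| + a ^ 2 * t ^ 2 := by
                rw [abs_mul, abs_of_nonneg (by positivity : 0 ≤ a ^ 2 * t ^ 2)]
            _ ≤ ε * (s ^ 2 + t ^ 2) + ε * t ^ 2 := by gcongr
            _ = _ := by ring
      _ = L * (ε * (2 * ∑ k, dotp (V k) x ^ 2 + ∑ k, dotp (V k) w ^ 2)) := by
          rw [← Finset.mul_sum, ← Finset.mul_sum, Finset.sum_add_distrib, ← Finset.mul_sum]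
      _ ≤ L * (ε * (2 * (C * p) + C * p)) := by
          have h1 := hsq x hx.le
          have h2 := hsq w hwn
          gcongr
      _ = _ := by ring
  -- step C
  have hCs : |∑ k, ψ (dotp (V k) x) * (dotp (V k) w ^ 2 - dotp (V k) w0 ^ 2)|
      ≤ (L * ε * C + L * (1 / ε + 1) * C / d) * p := by
    calc _ ≤ ∑ k, |ψ (dotp (V k) x) * (dotp (V k) w ^ 2 - dotp (V k) w0 ^ 2)| :=
          Finset.abs_sum_le_sum_abs _ _
      _ ≤ ∑ k, L * (ε * dotp (V k) w ^ 2 + (1 / ε + 1) * dotp (V k) (w - w0) ^ 2) := by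
          refine Finset.sum_le_sum fun k _ => ?_
          rw [abs_mul]
          refine mul_le_mul (hL _) ?_ (abs_nonneg _) hL0
          rw [dotp_sub]
          set s := dotp (V k) w
          set t := dotp (V k) w0
          exact scalarC hε s t
      _ = L * (ε * ∑ k, dotp (V k) w ^ 2 + (1 / ε + 1) * ∑ k, dotp (V k) (w - w0) ^ 2) := by
          rw [← Finset.mul_sum, Finset.sum_add_distrib, ← Finset.mul_sum, ← Finset.mul_sum]
      _ ≤ L * (ε * (C * p) + (1 / ε + 1) * (C * p * (1 / d))) := by
          have h2 := hsq w hwn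
          have h3 : ∑ k, dotp (V k) (w - w0) ^ 2 ≤ C * p * (1 / d) := by
            refine (good_frob hd hm hG (w - w0)).trans ?_
            have : 2 * τ + 2 * m ^ 2 ≤ C := by rw [hC]; linarith
            have := nsq_nonneg (w - w0)
            gcongr
          gcongr
      _ = _ := by field_simp
  have hG3 := hG.g3 z hz hz4
  -- norms
  have hN : |nsq w0 / d - 1| ≤ ε + 3 / d := by
    have e1 : nsq w0 = nsq w - 2 * dotp w (w - w0) + nsq (w - w0) := by
      rw [← nsq_sub, sub_sub_cancel]
    have h1 : |2 * dotp w (w - w0)| ≤ 2 := by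
      have h := dotp_sq_le w (w - w0)
      have h2 : nsq w * nsq (w - w0) ≤ d * (1 / d) :=
        mul_le_mul hwn hrn (nsq_nonneg _) hd0.le
      rw [mul_one_div_cancel hd0.ne'] at h2
      have h3 : |dotp w (w - w0)| ≤ 1 := abs_le_of_sq_le_sq (by linarith) zero_le_one
      rw [abs_mul, abs_two]; linarith
    have h2 : 1 / (d : ℝ) ≤ 1 := by rw [div_le_one hd0]; exact hd1
    have h3 := nsq_nonneg (w - w0)
    have h4 := abs_le.1 h1
    have h5 : a ^ 2 ≤ ε := by nlinarith
    have h6 := sq_nonneg a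
    have e2 : nsq w0 / d - 1 = -a ^ 2 + (nsq (w - w0) - 2 * dotp w (w - w0)) / d := by
      rw [e1, hwn']; field_simp; ring
    rw [e2]
    have h7 : |(nsq (w - w0) - 2 * dotp w (w - w0)) / d| ≤ 3 / d := by
      rw [abs_div, abs_of_pos hd0]
      gcongr
      rw [abs_le]; constructor <;> linarith
    have h8 := abs_le.1 h7
    have h9 : 0 ≤ 3 / (d : ℝ) := by positivity
    rw [abs_le]; constructor <;> linarith
  have hNμ : |p * (μ * (nsq w0 / d)) - p * μ| ≤ |μ| * (ε + 3 / d) * p := by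
    have : p * (μ * (nsq w0 / d)) - p * μ = μ * (nsq w0 / d - 1) * p := by ring
    rw [this, abs_mul, abs_mul, abs_of_nonneg hp0]
    gcongr
  have hsplit : ∑ k, ψ (dotp (V k) (x + e)) * dotp (V k) y ^ 2 - p * μ
      = ∑ k, (ψ (dotp (V k) (x + e)) - ψ (dotp (V k) x)) * dotp (V k) y ^ 2
        + ∑ k, ψ (dotp (V k) x) * (dotp (V k) y ^ 2 - dotp (V k) w ^ 2)
        + ∑ k, ψ (dotp (V k) x) * (dotp (V k) w ^ 2 - dotp (V k) w0 ^ 2)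
        + (∑ k, ψ (dotp (V k) x) * dotp (V k) w0 ^ 2 - p * (μ * (nsq w0 / d)))
        + (p * (μ * (nsq w0 / d)) - p * μ) := by
    have : ∑ k, ψ (dotp (V k) (x + e)) * dotp (V k) y ^ 2
      = ∑ k, (ψ (dotp (V k) (x + e)) - ψ (dotp (V k) x)) * dotp (V k) y ^ 2
        + ∑ k, ψ (dotp (V k) x) * (dotp (V k) y ^ 2 - dotp (V k) w ^ 2)
        + ∑ k, ψ (dotp (V k) x) * (dotp (V k) w ^ 2 - dotp (V k) w0 ^ 2)
        + ∑ k, ψ (dotp (V k) x) * dotp (V k) w0 ^ 2 := by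
      rw [← Finset.sum_add_distrib, ← Finset.sum_add_distrib, ← Finset.sum_add_distrib]
      exact Finset.sum_congr rfl fun k _ => by ring
    rw [this]; ring
  rw [hsplit]
  calc _ ≤ (12 * L * τ + ε * (m ^ 2 * L' * (1 + C))) * p + 3 * L * ε * C * p
        + (L * ε * C + L * (1 / ε + 1) * C / d) * p + τ * p + |μ| * (ε + 3 / d) * p := by
        refine (abs_add_le _ _).trans (add_le_add ?_ hNμ)
        refine (abs_add_le _ _).trans (add_le_add ?_ hG3)
        refine (abs_add_le _ _).trans (add_le_add ?_ hCs)
        exact (abs_add_le _ _).trans (add_le_add hA hB)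
    _ = ((12 * L + 1) * τ + ε * (m ^ 2 * L' * (1 + C) + 4 * L * C + |μ|)
        + (L * (1 / ε + 1) * C + 3 * |μ|) / d) * p := by field_simp; ring
    _ ≤ η * p := by
        gcongr
        linarith

end det

lemma bad_psi {p d : ℕ} (hd : 0 < d) {τ m : ℝ}
    (hmgf : ∀ s : ℝ, |s| ≤ 2 →
      Integrable (fun g => Real.exp (psi m (s * g) ^ 2 / 16)) (gaussianReal 0 1) ∧
      ∫ g, Real.exp (psi m (s * g) ^ 2 / 16) ∂(gaussianReal 0 1) ≤ Real.exp (τ / 32))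
    (z : Fin d → ℝ) (hz : nsq z ≤ 4 * d) :
    gaussianMatrix p d {V | ¬ ∑ k, psi m (dotp (V k) z) ^ 2 ≤ τ * p}
      ≤ ENNReal.ofReal (Real.exp (-(τ / 32) * p)) := by
  have hd0 : (0 : ℝ) < d := by positivity
  set s := Real.sqrt (nsq z / d) with hs
  have hs2 : nsq z / d = s ^ 2 := (Real.sq_sqrt (div_nonneg (nsq_nonneg z) hd0.le)).symm
  have hsa : |s| ≤ 2 := by
    apply abs_le_of_sq_le_sq _ (by norm_num)
    rw [← hs2, div_le_iff₀ hd0]; linarith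
  obtain ⟨h1, h2⟩ := hmgf s hsa
  have hlaw := rowMeasure_map z s hs2
  have hcont : Continuous (fun g : ℝ => Real.exp (psi m g ^ 2 / 16)) := by
    have := continuous_psi m; fun_prop
  have hm1 : Measurable (fun g : ℝ => s * g) := by fun_prop
  have hI : Integrable (fun v => Real.exp (psi m (dotp v z) ^ 2 / 16)) (rowMeasure d) := by
    have : Integrable (fun g : ℝ => Real.exp (psi m g ^ 2 / 16))
        ((rowMeasure d).map (fun v => dotp v z)) := by
      rw [hlaw]
      exact (integrable_map_measure hcont.aestronglyMeasurable hm1.aemeasurable).2 h1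
    exact (integrable_map_measure hcont.aestronglyMeasurable (measurable_dotp z).aemeasurable).1 this
  have hE : ∫ v, Real.exp (psi m (dotp v z) ^ 2 / 16) ∂(rowMeasure d) ≤ Real.exp (τ / 32) := by
    have e1 := integral_map (μ := rowMeasure d) (measurable_dotp z).aemeasurable
      hcont.aestronglyMeasurable
    rw [← e1, hlaw, integral_map hm1.aemeasurable hcont.aestronglyMeasurable]
    exact h2
  have hch := chernoff (p := p) (fun v => psi m (dotp v z) ^ 2 / 16) hI (τ / 32) (τ / 16) hE
  refine (measure_mono ?_).trans (hch.trans (le_of_eq ?_))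
  · intro V hV
    simp only [Set.mem_setOf_eq, not_le] at hV ⊢
    rw [← Finset.sum_div]
    linarith
  · congr 3; ring

lemma bad_main {p d : ℕ} (hd : 0 < d) {ψ : ℝ → ℝ} (hc : Continuous ψ) {μ θ₀ K : ℝ} (hK : 0 ≤ K)
    (hmgf : ∀ θ : ℝ, |θ| ≤ θ₀ →
      Integrable (fun q : ℝ × ℝ => Real.exp (θ * (ψ q.1 * q.2 ^ 2 - μ)))
        ((gaussianReal 0 1).prod (gaussianReal 0 1)) ∧
      ∫ q : ℝ × ℝ, Real.exp (θ * (ψ q.1 * q.2 ^ 2 - μ))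
        ∂((gaussianReal 0 1).prod (gaussianReal 0 1)) ≤ Real.exp (θ ^ 2 * K))
    {l τ : ℝ} (hl : 0 < l) (hl1 : 4 * l ≤ θ₀) (hl2 : 16 * l ^ 2 * K ≤ l * τ / 2)
    (σ : ℝ) (hσ : |σ| = l)
    (x w : Fin d → ℝ) (hx : nsq x = d) (hw : nsq w ≤ 4 * d) (hxw : dotp x w = 0) :
    gaussianMatrix p d {V | l * τ * p ≤
        ∑ k, σ * (ψ (dotp (V k) x) * dotp (V k) w ^ 2 - μ * (nsq w / d))}
      ≤ ENNReal.ofReal (Real.exp (-(l * τ / 2) * p)) := by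
  have hd0 : (0 : ℝ) < d := by positivity
  set s := Real.sqrt (nsq w / d) with hs
  have hs2 : nsq w / d = s ^ 2 := (Real.sq_sqrt (div_nonneg (nsq_nonneg w) hd0.le)).symm
  have hs4 : s ^ 2 ≤ 4 := by
    rw [← hs2, div_le_iff₀ hd0]; linarith
  have hθ : |σ * s ^ 2| ≤ 4 * l := by
    rw [abs_mul, hσ, abs_of_nonneg (sq_nonneg s)]; nlinarith
  obtain ⟨h1, h2⟩ := hmgf (σ * s ^ 2) (hθ.trans hl1)
  have hlaw := rowMeasure_map_pair hd x w s hx hs2 hxw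
  set F : ℝ × ℝ → ℝ := fun q => Real.exp (σ * (ψ q.1 * q.2 ^ 2 - μ * (nsq w / d))) with hF
  have hcont : Continuous F := by fun_prop
  have hm1 : Measurable (fun q : ℝ × ℝ => (q.1, s * q.2)) := by fun_prop
  have hm2 : Measurable (fun v : Fin d → ℝ => (dotp v x, dotp v w)) :=
    (measurable_dotp x).prodMk (measurable_dotp w)
  have hFs : ∀ q : ℝ × ℝ, F (q.1, s * q.2) = Real.exp (σ * s ^ 2 * (ψ q.1 * q.2 ^ 2 - μ)) := by
    intro q; simp only [hF]; rw [hs2]; congr 1; ring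
  have hI : Integrable (fun v => F (dotp v x, dotp v w)) (rowMeasure d) := by
    have : Integrable F ((rowMeasure d).map (fun v => (dotp v x, dotp v w))) := by
      rw [hlaw]
      refine (integrable_map_measure hcont.aestronglyMeasurable hm1.aemeasurable).2 ?_
      refine h1.congr (ae_of_all _ fun q => ?_)
      exact (hFs q).symm
    exact (integrable_map_measure hcont.aestronglyMeasurable hm2.aemeasurable).1 this
  have hE : ∫ v, F (dotp v x, dotp v w) ∂(rowMeasure d) ≤ Real.exp (l * τ / 2) := by
    have e1 := integral_map (μ := rowMeasure d) hm2.aemeasurable hcont.aestronglyMeasurable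
    rw [← e1, hlaw, integral_map hm1.aemeasurable hcont.aestronglyMeasurable]
    simp_rw [hFs]
    refine h2.trans (Real.exp_le_exp.2 ?_)
    have h3 : (σ * s ^ 2) ^ 2 ≤ (4 * l) ^ 2 := sq_le_sq' (abs_le.1 hθ).1 (abs_le.1 hθ).2
    have h4 := mul_le_mul_of_nonneg_right h3 hK
    linarith
  have hch := chernoff (p := p) (fun v => σ * (ψ (dotp v x) * dotp v w ^ 2 - μ * (nsq w / d)))
    hI (l * τ / 2) (l * τ) hE
  refine hch.trans (le_of_eq ?_)
  congr 3; ring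

lemma bad_total {p d : ℕ} (hd : 0 < d) {ψ : ℝ → ℝ} (hc : Continuous ψ) {μ θ₀ K m : ℝ} (hK : 0 ≤ K)
    (hmgf : ∀ θ : ℝ, |θ| ≤ θ₀ →
      Integrable (fun q : ℝ × ℝ => Real.exp (θ * (ψ q.1 * q.2 ^ 2 - μ)))
        ((gaussianReal 0 1).prod (gaussianReal 0 1)) ∧
      ∫ q : ℝ × ℝ, Real.exp (θ * (ψ q.1 * q.2 ^ 2 - μ))
        ∂((gaussianReal 0 1).prod (gaussianReal 0 1)) ≤ Real.exp (θ ^ 2 * K))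
    {l τ : ℝ} (hl : 0 < l) (hl1 : 4 * l ≤ θ₀) (hl2 : 16 * l ^ 2 * K ≤ l * τ / 2)
    (hmgf2 : ∀ s : ℝ, |s| ≤ 2 →
      Integrable (fun g => Real.exp (psi m (s * g) ^ 2 / 16)) (gaussianReal 0 1) ∧
      ∫ g, Real.exp (psi m (s * g) ^ 2 / 16) ∂(gaussianReal 0 1) ≤ Real.exp (τ / 32))
    {c : ℝ} (hc1 : c ≤ τ / 32) (hc2 : c ≤ l * τ / 2)
    (x : Fin d → ℝ) (hx : nsq x = d) :
    gaussianMatrix p d {V | ¬ Good ψ μ m τ x V}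
      ≤ ENNReal.ofReal (4 * (2 * (d : ℝ) ^ 2 + 1) ^ d * Real.exp (-c * p)) := by
  classical
  set N := (net d).filter (fun z => nsq z ≤ 4 * d) with hN
  set E := ENNReal.ofReal (Real.exp (-c * p)) with hE
  have hp0 : (0 : ℝ) ≤ p := Nat.cast_nonneg p
  have hE1 : ENNReal.ofReal (Real.exp (-(τ / 32) * p)) ≤ E := by
    apply ENNReal.ofReal_le_ofReal; apply Real.exp_le_exp.2; nlinarith
  have hE2 : ENNReal.ofReal (Real.exp (-(l * τ / 2) * p)) ≤ E := by
    apply ENNReal.ofReal_le_ofReal; apply Real.exp_le_exp.2; nlinarith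
  let A : (Fin d → ℝ) → Set (Fin p → Fin d → ℝ) := fun z =>
    {V | ¬ ∑ k, psi m (dotp (V k) z) ^ 2 ≤ τ * p}
  let B : ℝ → (Fin d → ℝ) → Set (Fin p → Fin d → ℝ) := fun σ z => {V | l * τ * p ≤
        ∑ k, σ * (ψ (dotp (V k) x) * dotp (V k) (proj x z) ^ 2 - μ * (nsq (proj x z) / d))}
  have hsub : {V | ¬ Good ψ μ m τ x V} ⊆
      (⋃ z ∈ N, (A z ∪ (B l z ∪ B (-l) z))) ∪ ⋃ j ∈ (Finset.univ : Finset (Fin d)),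
        A (Pi.single j (Real.sqrt d)) := by
    intro V hV
    by_contra hcon
    simp only [Set.mem_union, Set.mem_iUnion, not_or, not_exists] at hcon
    obtain ⟨h1, h2⟩ := hcon
    apply hV
    refine ⟨fun z hz hz4 => ?_, fun j => ?_, fun z hz hz4 => ?_⟩
    · have := (h1 z (Finset.mem_filter.2 ⟨hz, hz4⟩)).1
      simpa [A] using this
    · have := h2 j (Finset.mem_univ j)
      simpa [A] using this
    · have h3 := (h1 z (Finset.mem_filter.2 ⟨hz, hz4⟩)).2.1
      have h4 := (h1 z (Finset.mem_filter.2 ⟨hz, hz4⟩)).2.2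
      simp only [B, Set.mem_setOf_eq, not_le, ← Finset.mul_sum, Finset.sum_sub_distrib,
        Finset.sum_const, Finset.card_univ, Fintype.card_fin, nsmul_eq_mul] at h3 h4
      rw [mul_assoc] at h3
      have h3' := lt_of_mul_lt_mul_left h3 hl.le
      have h4' : l * (-(∑ k, ψ (dotp (V k) x) * dotp (V k) (proj x z) ^ 2
          - p * (μ * (nsq (proj x z) / d)))) < l * (τ * p) := by linarith
      have h4'' := lt_of_mul_lt_mul_left h4' hl.le
      rw [abs_le]; constructor <;> linarith
  have hA : ∀ z, nsq z ≤ 4 * d → gaussianMatrix p d (A z) ≤ E := fun z hz =>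
    (bad_psi hd hmgf2 z hz).trans hE1
  have hB : ∀ σ, |σ| = l → ∀ z, nsq z ≤ 4 * d → gaussianMatrix p d (B σ z) ≤ E := fun σ hσ z hz =>
    (bad_main hd hc hK hmgf hl hl1 hl2 σ hσ x (proj x z) hx
      ((nsq_proj_le hd x z hx).trans hz) (dotp_proj hd x z hx)).trans hE2
  have hNc : (N.card : ℝ) ≤ (2 * (d : ℝ) ^ 2 + 1) ^ d := by
    have : N.card ≤ (2 * d ^ 2 + 1) ^ d := (Finset.card_filter_le _ _).trans (net_card d)
    exact_mod_cast this
  have hdc : (d : ℝ) ≤ (2 * (d : ℝ) ^ 2 + 1) ^ d := by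
    have : d ≤ (2 * d ^ 2 + 1) ^ d := by
      have h1 : 1 < 2 * d ^ 2 + 1 := by have : 0 < d ^ 2 := by positivity
                                        omega
      exact (Nat.lt_pow_self h1).le
    exact_mod_cast this
  calc gaussianMatrix p d {V | ¬ Good ψ μ m τ x V}
      ≤ gaussianMatrix p d (⋃ z ∈ N, (A z ∪ (B l z ∪ B (-l) z)))
        + gaussianMatrix p d (⋃ j ∈ (Finset.univ : Finset (Fin d)), A (Pi.single j (Real.sqrt d))) :=
        (measure_mono hsub).trans (measure_union_le _ _)
    _ ≤ ∑ _z ∈ N, (E + (E + E)) + ∑ _j : Fin d, E := by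
        gcongr
        · refine (measure_biUnion_finset_le _ _).trans (Finset.sum_le_sum fun z hz => ?_)
          have hz4 := (Finset.mem_filter.1 hz).2
          refine (measure_union_le _ _).trans (add_le_add (hA z hz4) ?_)
          exact (measure_union_le _ _).trans (add_le_add (hB l (abs_of_pos hl) z hz4)
            (hB (-l) (by rw [abs_neg, abs_of_pos hl]) z hz4))
        · refine (measure_biUnion_finset_le _ _).trans (Finset.sum_le_sum fun j _ => ?_)
          apply hA
          have : nsq (Pi.single j (Real.sqrt d) : Fin d → ℝ) = d := by
            simp [nsq, Pi.single_apply, ite_pow]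
          rw [this]
          linarith [(Nat.cast_nonneg d : (0 : ℝ) ≤ d)]
    _ = ENNReal.ofReal ((3 * N.card + d) * Real.exp (-c * p)) := by
        rw [ENNReal.ofReal_mul (by positivity), ENNReal.ofReal_add (by positivity) (by positivity),
          ENNReal.ofReal_mul (by norm_num), ENNReal.ofReal_natCast, ENNReal.ofReal_natCast, ← hE]
        simp only [Finset.sum_const, nsmul_eq_mul, Finset.card_univ, Fintype.card_fin]
        simp
        ring
    _ ≤ _ := by
        apply ENNReal.ofReal_le_ofReal
        gcongr
        linarith

lemma tail_bound (p : ℕ → ℕ)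
    (hp : Tendsto (fun d : ℕ => (p d : ℝ) / ((d : ℝ) * (Real.log d) ^ 2)) atTop atTop)
    {c : ℝ} (hc : 0 < c) : ∀ᶠ d : ℕ in atTop,
      4 * (2 * (d : ℝ) ^ 2 + 1) ^ d * Real.exp (-c * p d) ≤ 2 * Real.exp (-1 * (Real.log d) ^ 2) := by
  filter_upwards [hp.eventually_ge_atTop (6 / c), eventually_ge_atTop 3] with d h1 hd
  have hd3 : (3 : ℝ) ≤ d := by exact_mod_cast hd
  have hd0 : (0 : ℝ) < d := by linarith
  have hlog : 1 ≤ Real.log d := by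
    rw [Real.le_log_iff_exp_le hd0]
    linarith [Real.exp_one_lt_d9]
  set ℓ := Real.log d with hℓ
  have h2 : 6 * (d * ℓ ^ 2) ≤ c * p d := by
    rw [le_div_iff₀ (by positivity), div_mul_eq_mul_div, div_le_iff₀ hc] at h1
    linarith
  have h3 : (2 * (d : ℝ) ^ 2 + 1) ^ d ≤ Real.exp (3 * d * ℓ) := by
    have : 2 * (d : ℝ) ^ 2 + 1 ≤ (d : ℝ) ^ 3 := by nlinarith [sq_nonneg (d : ℝ)]
    calc (2 * (d : ℝ) ^ 2 + 1) ^ d ≤ ((d : ℝ) ^ 3) ^ d := by gcongr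
      _ = Real.exp (3 * d * ℓ) := by
        rw [show 3 * d * ℓ = ((3 * d : ℕ) : ℝ) * ℓ by push_cast; ring, Real.exp_nat_mul, hℓ,
          Real.exp_log hd0, pow_mul]
  have h4 : (2 : ℝ) ≤ Real.exp (d * ℓ ^ 2) := by
    have := Real.add_one_le_exp (d * ℓ ^ 2)
    nlinarith
  have hl2 : ℓ ≤ ℓ ^ 2 := by nlinarith
  calc 4 * (2 * (d : ℝ) ^ 2 + 1) ^ d * Real.exp (-c * p d)
      ≤ 2 * Real.exp (d * ℓ ^ 2) * Real.exp (3 * d * ℓ) * Real.exp (-c * p d) := by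
        gcongr; linarith
    _ = 2 * Real.exp (d * ℓ ^ 2 + 3 * d * ℓ + -c * p d) := by
        rw [Real.exp_add, Real.exp_add]; ring
    _ ≤ _ := by
        gcongr
        have : d * ℓ ≤ d * ℓ ^ 2 := by gcongr
        have : ℓ ^ 2 ≤ d * ℓ ^ 2 := by nlinarith [sq_nonneg ℓ]
        linarith

lemma eNorm_sq {d : ℕ} (x : Fin d → ℝ) : eNorm x ^ 2 = nsq x :=
  Real.sq_sqrt (nsq_nonneg x)

lemma nsq_of_eNorm {d : ℕ} {x : Fin d → ℝ} (h : eNorm x = Real.sqrt d) : nsq x = d := by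
  rw [← eNorm_sq, h, Real.sq_sqrt (Nat.cast_nonneg d)]

/-- Homogeneity. -/
lemma good_final {p d : ℕ} {ψ : ℝ → ℝ} {μ η ε : ℝ} {x : Fin d → ℝ} {V : Fin p → Fin d → ℝ}
    (hd : 0 < d) (hε : 0 < ε) (hx : eNorm x = Real.sqrt d)
    (H : ∀ y e : Fin d → ℝ, nsq y = d → dotp x y ^ 2 ≤ ε ^ 2 * d ^ 2 → nsq e ≤ ε ^ 2 * d →
      |∑ k, ψ (dotp (V k) (x + e)) * dotp (V k) y ^ 2 - p * μ| ≤ η * p)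
    (e₁ e₂ : Fin d → ℝ) (h1 : eNorm (x + e₁) = Real.sqrt d) (h2 : eNorm (x + e₂) = Real.sqrt d)
    (hmax : max (eNorm e₁) (eNorm e₂) ≤ ε * Real.sqrt d) :
    |dotp (fun k => dotp (V k) (e₂ - e₁))
        (fun k => ψ (dotp (V k) (x + e₁)) * dotp (V k) (e₂ - e₁)) -
      (eNorm (e₂ - e₁)) ^ 2 / (d : ℝ) * p * μ| ≤
      η * p * (eNorm (e₂ - e₁) / Real.sqrt d) ^ 2 := by
  have hd0 : (0 : ℝ) < d := by positivity
  have hball : ∀ e : Fin d → ℝ, eNorm e ≤ ε * Real.sqrt d → nsq e ≤ ε ^ 2 * d := by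
    intro e he
    have h := pow_le_pow_left₀ (show 0 ≤ eNorm e from Real.sqrt_nonneg _) he 2
    rw [mul_pow, Real.sq_sqrt hd0.le, eNorm_sq] at h
    exact h
  have hn1 := hball e₁ ((le_max_left _ _).trans hmax)
  have hn2 := hball e₂ ((le_max_right _ _).trans hmax)
  have hx' := nsq_of_eNorm hx
  have h1' := nsq_of_eNorm h1
  have h2' := nsq_of_eNorm h2
  rw [nsq_add, hx'] at h1' h2'
  rw [div_pow, Real.sq_sqrt hd0.le, eNorm_sq]
  set u := e₂ - e₁ with hu
  set U := nsq u with hU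
  have hsum : dotp (fun k => dotp (V k) u) (fun k => ψ (dotp (V k) (x + e₁)) * dotp (V k) u)
      = ∑ k, ψ (dotp (V k) (x + e₁)) * dotp (V k) u ^ 2 := by
    unfold dotp
    exact Finset.sum_congr rfl fun k _ => by ring
  rw [hsum]
  rcases (nsq_nonneg u).eq_or_lt with h0 | hpos
  · have hz : ∀ k, dotp (V k) u ^ 2 = 0 := by
      intro k
      have := dotp_sq_le (V k) u
      rw [← h0, mul_zero] at this
      exact le_antisymm this (sq_nonneg _)
    rw [hU, ← h0]
    simp [hz]
  · have hUpos : 0 < U := hpos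
    have hU0 : U ≠ 0 := hUpos.ne'
    set r := Real.sqrt (d / U) with hr
    have hr2 : r ^ 2 = d / U := Real.sq_sqrt (by positivity)
    have hxu : dotp x u ^ 2 ≤ U * (ε ^ 2 * d) := by
      have e1 : dotp x u = -(1 / 2) * dotp u (e₁ + e₂) := by
        have : dotp u (e₁ + e₂) = nsq e₂ - nsq e₁ := by
          rw [dotp_comm', hu, dotp_sub, dotp_comm' _ e₂, dotp_comm' _ e₁, dotp_add, dotp_add,
            ← nsq_eq, ← nsq_eq, dotp_comm' e₂ e₁]; ring
        rw [this, hu, dotp_sub]; linarith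
      have e2 := dotp_sq_le u (e₁ + e₂)
      have e3 : nsq (e₁ + e₂) ≤ 4 * (ε ^ 2 * d) := by
        have a1 := nsq_add e₁ e₂
        have a2 := nsq_sub e₁ e₂
        have a3 := nsq_nonneg (e₁ - e₂)
        linarith
      have e4 : U * nsq (e₁ + e₂) ≤ U * (4 * (ε ^ 2 * d)) := by gcongr
      rw [e1, mul_pow]
      nlinarith
    have key := H (r • u) e₁ ?_ ?_ hn1
    · have e5 : ∑ k, ψ (dotp (V k) (x + e₁)) * dotp (V k) (r • u) ^ 2
          = d / U * ∑ k, ψ (dotp (V k) (x + e₁)) * dotp (V k) u ^ 2 := by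
        rw [Finset.mul_sum]
        refine Finset.sum_congr rfl fun k _ => ?_
        rw [dotp_smul, mul_pow, hr2]; ring
      rw [e5] at key
      set S := ∑ k, ψ (dotp (V k) (x + e₁)) * dotp (V k) u ^ 2
      have e6 : S - U / d * p * μ = U / d * (d / U * S - p * μ) := by
        field_simp
      rw [e6, abs_mul, abs_of_pos (by positivity : 0 < U / (d : ℝ)), mul_comm (η * (p : ℝ))]
      gcongr
    · rw [nsq_smul, hr2]; exact div_mul_cancel₀ _ hU0
    · rw [dotp_smul, mul_pow, hr2, div_mul_eq_mul_div, div_le_iff₀ hpos]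
      nlinarith
/-- **Lemma A.8 (Alignment of the first-order feature increment).**
For `φ` Lipschitz with Lipschitz derivative and `p/(d log² d) → ∞`: for every `η > 0`
there are `ε₀, c > 0` and `D` such that for all `d ≥ D` and every `x₁` with `‖x₁‖₂ = √d`,
with probability at least `1 − 2 exp(−c log² d)` over `V`, simultaneously for all
`ε₁, ε₂` with `‖x₁+ε₁‖₂ = ‖x₁+ε₂‖₂ = √d` and `max(‖ε₁‖₂, ‖ε₂‖₂) ≤ ε₀ √d`:
`|(ε₂−ε₁)ᵀVᵀ(φ'(V(x₁+ε₁)) ∘ (V(ε₂−ε₁))) − (‖ε₂−ε₁‖₂²/d) p μ₁| ≤ η p δ²`. -/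
theorem first_order_increment_alignment
    (φ : ℝ → ℝ) (hLip : ∃ L : NNReal, LipschitzWith L φ)
    (hdiff : Differentiable ℝ φ) (hLip' : ∃ L' : NNReal, LipschitzWith L' (deriv φ))
    (p : ℕ → ℕ)
    (hp : Tendsto (fun d : ℕ => (p d : ℝ) / ((d : ℝ) * (Real.log d) ^ 2)) atTop atTop) :
    ∀ η : ℝ, 0 < η → ∃ ε₀ : ℝ, 0 < ε₀ ∧ ∃ c : ℝ, 0 < c ∧ ∃ D : ℕ, ∀ d : ℕ, D ≤ d →
      ∀ x₁ : Fin d → ℝ, eNorm x₁ = Real.sqrt d →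
        1 - ENNReal.ofReal (2 * Real.exp (-c * (Real.log d) ^ 2)) ≤
          gaussianMatrix (p d) d
            {V | ∀ ε₁ ε₂ : Fin d → ℝ,
              eNorm (x₁ + ε₁) = Real.sqrt d → eNorm (x₁ + ε₂) = Real.sqrt d →
              max (eNorm ε₁) (eNorm ε₂) ≤ ε₀ * Real.sqrt d →
              |dotp (fun k => dotp (V k) (ε₂ - ε₁))
                  (fun k => deriv φ (dotp (V k) (x₁ + ε₁)) * dotp (V k) (ε₂ - ε₁)) -
                (eNorm (ε₂ - ε₁)) ^ 2 / (d : ℝ) * (p d) * hermiteCoeff φ 1| ≤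
                η * (p d) * (eNorm (ε₂ - ε₁) / Real.sqrt d) ^ 2} := by
  intro η hη
  obtain ⟨L, hL⟩ := hLip
  obtain ⟨L', hL'⟩ := hLip'
  have hc : Continuous (deriv φ) := hL'.continuous
  have hb : ∀ t, |deriv φ t| ≤ L := fun t => by
    simpa using norm_deriv_le_of_lipschitz (x₀ := t) hL
  have hb' : ∀ s t, |deriv φ s - deriv φ t| ≤ L' * |s - t| := fun s t => by
    have := hL'.dist_le_mul s t
    rwa [Real.dist_eq, Real.dist_eq] at this
  set μ := hermiteCoeff φ 1 with hμ
  have hL0 : (0 : ℝ) ≤ L := L.2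
  have hL'0 : (0 : ℝ) ≤ L' := L'.2
  -- choose the truncation error
  set τ : ℝ := η / (4 * (12 * L + 1)) with hτ
  have hτ0 : 0 < τ := by positivity
  have hη1 : (12 * L + 1) * τ ≤ η / 4 := by
    rw [hτ]; apply le_of_eq; field_simp
  obtain ⟨m, hm0, hmgf2⟩ := trunc_mgf (τ / 32) (by positivity)
  set C : ℝ := 6 * τ + 2 * m ^ 2 with hC
  have hC0 : 0 < C := by positivity
  -- choose ε
  set M : ℝ := m ^ 2 * L' * (1 + C) + 4 * L * C + |μ| with hM
  have hM0 : 0 ≤ M := by positivity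
  set ε : ℝ := min 1 (η / (4 * (M + 1))) with hε
  have hε0 : 0 < ε := lt_min one_pos (by positivity)
  have hε1 : ε ≤ 1 := min_le_left _ _
  have hη2 : ε * M ≤ η / 4 := by
    have h1 : ε ≤ η / (4 * (M + 1)) := min_le_right _ _
    rw [le_div_iff₀ (by positivity)] at h1
    nlinarith
  -- Chernoff parameters
  obtain ⟨θ₀, hθ₀, K, hK, hmgf⟩ := main_mgf (deriv φ) hc L hb μ (stein hL hdiff hc)
  set l : ℝ := min (θ₀ / 4) (τ / (32 * (K + 1))) with hl
  have hl0 : 0 < l := lt_min (by positivity) (by positivity)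
  have hl1 : 4 * l ≤ θ₀ := by have : l ≤ θ₀ / 4 := min_le_left _ _; linarith
  have hl2 : 16 * l ^ 2 * K ≤ l * τ / 2 := by
    have h1 : l ≤ τ / (32 * (K + 1)) := min_le_right _ _
    rw [le_div_iff₀ (by positivity)] at h1
    have h2 : l * (l * (32 * (K + 1))) ≤ l * τ := by gcongr
    nlinarith [sq_nonneg l]
  set c : ℝ := min (τ / 32) (l * τ / 2) with hcdef
  have hc0 : 0 < c := lt_min (by positivity) (by positivity)
  refine ⟨ε, hε0, 1, one_pos, ?_⟩
  have ht : Tendsto (fun d : ℕ => (d : ℝ)) atTop atTop := tendsto_natCast_atTop_atTop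
  have hev := ((tail_bound p hp hc0).and (eventually_gt_atTop 0)).and
    ((ht.eventually_ge_atTop (2 * C / τ)).and
      (ht.eventually_ge_atTop ((L * (1 / ε + 1) * C + 3 * |μ|) / (η / 4))))
  obtain ⟨D, hD⟩ := eventually_atTop.1 hev
  refine ⟨D, fun d hdD x hx => ?_⟩
  obtain ⟨⟨htail, hd⟩, hd1, hd2⟩ := hD d hdD
  have hd0 : (0 : ℝ) < d := by positivity
  have hdl : 2 * (6 * τ + 2 * m ^ 2) ≤ τ * d := by
    rw [div_le_iff₀ hτ0] at hd1; linarith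
  have hη3 : (L * (1 / ε + 1) * C + 3 * |μ|) / d ≤ η / 4 := by
    rw [div_le_iff₀ (by positivity)] at hd2
    rw [div_le_iff₀ hd0]; linarith
  have hxn := nsq_of_eNorm hx
  have hbad := bad_total (p := p d) hd hc hK hmgf hl0 hl1 hl2 hmgf2 (min_le_left _ _)
    (min_le_right _ _ : c ≤ _) x hxn
  have hbad' := hbad.trans (ENNReal.ofReal_le_ofReal htail)
  rw [tsub_le_iff_right]
  set S := {V : Fin (p d) → Fin d → ℝ | ∀ ε₁ ε₂ : Fin d → ℝ,
              eNorm (x + ε₁) = Real.sqrt d → eNorm (x + ε₂) = Real.sqrt d →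
              max (eNorm ε₁) (eNorm ε₂) ≤ ε * Real.sqrt d →
              |dotp (fun k => dotp (V k) (ε₂ - ε₁))
                  (fun k => deriv φ (dotp (V k) (x + ε₁)) * dotp (V k) (ε₂ - ε₁)) -
                (eNorm (ε₂ - ε₁)) ^ 2 / (d : ℝ) * (p d) * μ| ≤
                η * (p d) * (eNorm (ε₂ - ε₁) / Real.sqrt d) ^ 2} with hS
  have hsub : (Set.univ : Set (Fin (p d) → Fin d → ℝ)) ⊆
      S ∪ {V | ¬ Good (deriv φ) μ m τ x V} := by
    intro V _
    by_cases hG : Good (deriv φ) μ m τ x V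
    · left
      intro e₁ e₂ h1 h2 h3
      exact good_final hd hε0 hx (fun y e hy hxy he =>
        good_main hd hm0.le hτ0.le hG hdl hxn hb hb' hL'0 hε0 hε1 y e hy hxy he hC hη1 hη2 hη3 hη)
        e₁ e₂ h1 h2 h3
    · right; exact hG
  calc (1 : ENNReal) = gaussianMatrix (p d) d Set.univ := measure_univ.symm
    _ ≤ _ := (measure_mono hsub).trans (measure_union_le _ _)
    _ ≤ _ := by gcongr
end
end
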